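/- arXiv:math-ph/0601057 — 2 statements merged into one kernel-verified Lean document; each statement's English description precedes it below -/
import Mathlib

section
/- The function (γ,ξ) ↦ μ⁽¹⁾(γ,ξ) is of class C^∞ on ℝ². -/
open MeasureTheory Set Filter

/-- An admissible function on the half-line `[0,∞)`: `u` is continuous on `[0,∞)`,
locally absolutely continuous with derivative `u'` (expressed by the integral
representation), and `u`, `u'`, `t·u(t)` all belong to `L²((0,∞))`. -/
structure AdmissibleHL (u u' : ℝ → ℂ) : Prop where
  cont : ContinuousOn u (Ici 0)
  locInt : ∀ t ∈ Ici (0:ℝ), IntervalIntegrable u' volume 0 t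
  ac : ∀ t ∈ Ici (0:ℝ), u t = u 0 + ∫ s in (0:ℝ)..t, u' s
  memL2 : IntegrableOn (fun t => ‖u t‖ ^ 2) (Ioi 0)
  memL2' : IntegrableOn (fun t => ‖u' t‖ ^ 2) (Ioi 0)
  memL2t : IntegrableOn (fun t => t ^ 2 * ‖u t‖ ^ 2) (Ioi 0)

/-- The quadratic form `q[γ,ξ](u) = ∫₀^∞ (|u'|² + (t-ξ)²|u|²) dt + γ|u(0)|²`. -/
noncomputable def qform (γ ξ : ℝ) (u u' : ℝ → ℂ) : ℝ :=
  (∫ t in Ioi (0:ℝ), (‖u' t‖ ^ 2 + (t - ξ) ^ 2 * ‖u t‖ ^ 2)) + γ * ‖u 0‖ ^ 2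

/-- The ground state energy `μ⁽¹⁾(γ,ξ)`: the infimum of the Rayleigh quotients of
the quadratic form `q[γ,ξ]` over admissible functions not identically zero. -/
noncomputable def mu1 (γ ξ : ℝ) : ℝ :=
  sInf { r : ℝ | ∃ u u' : ℝ → ℂ, AdmissibleHL u u' ∧ (∃ t ∈ Ici (0:ℝ), u t ≠ 0) ∧
    r = qform γ ξ u u' / ∫ t in Ioi (0:ℝ), ‖u t‖ ^ 2 }

/-- `Θ(γ) = inf_{ξ ∈ ℝ} μ⁽¹⁾(γ,ξ)`. -/
noncomputable def Theta (γ : ℝ) : ℝ := ⨅ ξ : ℝ, mu1 γ ξ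

/-- A ground state of `H[γ,ξ]` with eigenvalue `μ`: a twice continuously differentiable
positive function on `[0,∞)`, `L²`-normalized, with `φ, φ', t²·φ(t) ∈ L²((0,∞))`,
satisfying `-φ'' + (t-ξ)²φ = μ·φ` on `[0,∞)` and the boundary condition `φ'(0) = γ·φ(0)`. -/
structure IsGroundState (γ ξ μ : ℝ) (φ φ' φ'' : ℝ → ℝ) : Prop where
  deriv1 : ∀ t ∈ Ici (0:ℝ), HasDerivWithinAt φ (φ' t) (Ici 0) t
  deriv2 : ∀ t ∈ Ici (0:ℝ), HasDerivWithinAt φ' (φ'' t) (Ici 0) t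
  cont2 : ContinuousOn φ'' (Ici 0)
  pos : ∀ t ∈ Ici (0:ℝ), 0 < φ t
  normalized : (∫ t in Ioi (0:ℝ), (φ t) ^ 2) = 1
  memL2 : IntegrableOn (fun t => (φ t) ^ 2) (Ioi 0)
  memL2' : IntegrableOn (fun t => (φ' t) ^ 2) (Ioi 0)
  memL2t : IntegrableOn (fun t => (t ^ 2 * φ t) ^ 2) (Ioi 0)
  eqn : ∀ t ∈ Ici (0:ℝ), -φ'' t + (t - ξ) ^ 2 * φ t = μ * φ t
  bc : φ' 0 = γ * φ 0

section ParametricExponential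

variable {Ω : Type*} [MeasurableSpace Ω] {ν : Measure Ω} {X Y F : Ω → ℝ} {U : Set (ℝ × ℝ)}

/-- `∫ F exp(a X + b Y) dν` as a function of the parameter `(a, b)`. -/
noncomputable def expIntegral (ν : Measure Ω) (X Y F : Ω → ℝ) (θ : ℝ × ℝ) : ℝ :=
  ∫ s, F s * Real.exp (θ.1 * X s + θ.2 * Y s) ∂ν

/-- The weight `F exp(a X + b Y)` is integrable for every parameter `(a, b)` in `U`. -/
def ExpIntegrableOn (ν : Measure Ω) (X Y F : Ω → ℝ) (U : Set (ℝ × ℝ)) : Prop :=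
  ∀ θ ∈ U, Integrable (fun s => F s * Real.exp (θ.1 * X s + θ.2 * Y s)) ν

lemma exp_mul_le_corners {r a a₀ x : ℝ} (h : |a - a₀| ≤ r) :
    Real.exp (a * x) ≤ Real.exp ((a₀ + r) * x) + Real.exp ((a₀ - r) * x) := by
  obtain ⟨h1, h2⟩ := abs_le.1 h
  rcases le_total 0 x with hx | hx
  · have : Real.exp (a * x) ≤ Real.exp ((a₀ + r) * x) := Real.exp_le_exp.2 (by nlinarith)
    linarith [Real.exp_pos ((a₀ - r) * x)]
  · have : Real.exp (a * x) ≤ Real.exp ((a₀ - r) * x) := Real.exp_le_exp.2 (by nlinarith)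
    linarith [Real.exp_pos ((a₀ + r) * x)]

/-- The sum of `exp(a X + b Y)` over the four corners of the square of half-side `r` at `θ`. -/
noncomputable def cornerSum (θ : ℝ × ℝ) (r x y : ℝ) : ℝ :=
  (Real.exp ((θ.1 + r) * x) + Real.exp ((θ.1 - r) * x)) *
    (Real.exp ((θ.2 + r) * y) + Real.exp ((θ.2 - r) * y))

lemma exp_le_cornerSum {θ θ₀ : ℝ × ℝ} {r x y : ℝ} (h : θ ∈ Metric.closedBall θ₀ r) :
    Real.exp (θ.1 * x + θ.2 * y) ≤ cornerSum θ₀ r x y := by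
  rw [Metric.mem_closedBall, Prod.dist_eq, max_le_iff, Real.dist_eq, Real.dist_eq] at h
  rw [Real.exp_add, cornerSum]
  exact mul_le_mul (exp_mul_le_corners h.1) (exp_mul_le_corners h.2) (Real.exp_pos _).le
    (by positivity)

lemma ExpIntegrableOn.exists_cornerSum (hU : IsOpen U) (hF : ExpIntegrableOn ν X Y F U)
    {θ : ℝ × ℝ} (hθ : θ ∈ U) :
    ∃ r > 0, Metric.closedBall θ r ⊆ U ∧
      Integrable (fun s => F s * cornerSum θ r (X s) (Y s)) ν := by
  obtain ⟨r, hr, hrU⟩ := Metric.nhds_basis_closedBall.mem_iff.1 (hU.mem_nhds hθ)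
  refine ⟨r, hr, hrU, ?_⟩
  have key : ∀ σ τ : ℝ, |σ| ≤ r → |τ| ≤ r → Integrable
      (fun s => F s * Real.exp ((θ.1 + σ) * X s + (θ.2 + τ) * Y s)) ν := fun σ τ hσ hτ =>
    hF (θ.1 + σ, θ.2 + τ) (hrU (by simp [Prod.dist_eq, hσ, hτ]))
  have hr' : |r| ≤ r := (abs_of_pos hr).le
  have hr'' : |-r| ≤ r := by rw [abs_neg]; exact hr'
  refine ((((key r r hr' hr').add (key r (-r) hr' hr'')).add
    (key (-r) r hr'' hr')).add (key (-r) (-r) hr'' hr'')).congr (ae_of_all _ fun s => ?_)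
  simp only [Pi.add_apply, cornerSum, Real.exp_add, ← sub_eq_add_neg]
  ring

lemma abs_mul_exp_le {a b x y r : ℝ} (hr : 0 < r) :
    |x| * Real.exp (a * x + b * y) ≤ r⁻¹ * cornerSum (a, b) r x y := by
  have h1 : r * |x| ≤ Real.exp (r * |x|) := by linarith [Real.add_one_le_exp (r * |x|)]
  have h2 : Real.exp (r * |x|) * Real.exp (a * x) ≤
      Real.exp ((a + r) * x) + Real.exp ((a - r) * x) := by
    rw [← Real.exp_add]
    rcases abs_cases x with ⟨h, _⟩ | ⟨h, _⟩ <;> rw [h]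
    · rw [show r * x + a * x = (a + r) * x by ring]; linarith [Real.exp_pos ((a - r) * x)]
    · rw [show r * -x + a * x = (a - r) * x by ring]; linarith [Real.exp_pos ((a + r) * x)]
  have h3 : Real.exp (b * y) ≤ Real.exp ((b + r) * y) + Real.exp ((b - r) * y) :=
    exp_mul_le_corners (by simpa using hr.le)
  rw [le_inv_mul_iff₀ hr, cornerSum, Real.exp_add]
  calc r * (|x| * (Real.exp (a * x) * Real.exp (b * y)))
      = (r * |x| * Real.exp (a * x)) * Real.exp (b * y) := by ring
    _ ≤ (Real.exp (r * |x|) * Real.exp (a * x)) * Real.exp (b * y) := by gcongr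
    _ ≤ _ := by dsimp only; gcongr

lemma cornerSum_swap (a b r x y : ℝ) : cornerSum (b, a) r y x = cornerSum (a, b) r x y :=
  mul_comm _ _

lemma abs_mul_exp_le' {a b x y r : ℝ} (hr : 0 < r) :
    |y| * Real.exp (a * x + b * y) ≤ r⁻¹ * cornerSum (a, b) r x y := by
  rw [← cornerSum_swap, add_comm]
  exact abs_mul_exp_le hr

lemma ExpIntegrableOn.mul_left (hX : Measurable X) (hY : Measurable Y)
    (hFm : Measurable F) (hU : IsOpen U) (hF : ExpIntegrableOn ν X Y F U) :
    ExpIntegrableOn ν X Y (fun s => X s * F s) U := by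
  intro θ hθ
  obtain ⟨r, hr, -, hint⟩ := hF.exists_cornerSum hU hθ
  refine (hint.const_mul r⁻¹).mono (by fun_prop) (ae_of_all _ fun s => ?_)
  have h := abs_mul_exp_le (a := θ.1) (b := θ.2) (x := X s) (y := Y s) hr
  have hc : 0 ≤ cornerSum θ r (X s) (Y s) := by unfold cornerSum; positivity
  simp only [norm_mul, Real.norm_eq_abs, Real.abs_exp, abs_of_pos (inv_pos.2 hr), abs_of_nonneg hc]
  calc _ = |F s| * (|X s| * Real.exp (θ.1 * X s + θ.2 * Y s)) := by ring
    _ ≤ |F s| * (r⁻¹ * cornerSum θ r (X s) (Y s)) := by gcongr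
    _ = _ := by ring

lemma ExpIntegrableOn.mul_right (hX : Measurable X) (hY : Measurable Y)
    (hFm : Measurable F) (hU : IsOpen U) (hF : ExpIntegrableOn ν X Y F U) :
    ExpIntegrableOn ν X Y (fun s => Y s * F s) U := by
  intro θ hθ
  obtain ⟨r, hr, -, hint⟩ := hF.exists_cornerSum hU hθ
  refine (hint.const_mul r⁻¹).mono (by fun_prop) (ae_of_all _ fun s => ?_)
  have h := abs_mul_exp_le' (a := θ.1) (b := θ.2) (x := X s) (y := Y s) hr
  have hc : 0 ≤ cornerSum θ r (X s) (Y s) := by unfold cornerSum; positivity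
  simp only [norm_mul, Real.norm_eq_abs, Real.abs_exp, abs_of_pos (inv_pos.2 hr), abs_of_nonneg hc]
  calc _ = |F s| * (|Y s| * Real.exp (θ.1 * X s + θ.2 * Y s)) := by ring
    _ ≤ |F s| * (r⁻¹ * cornerSum θ r (X s) (Y s)) := by gcongr
    _ = _ := by ring

lemma ExpIntegrableOn.hasFDerivAt (hX : Measurable X) (hY : Measurable Y)
    (hFm : Measurable F) (hU : IsOpen U) (hF : ExpIntegrableOn ν X Y F U)
    {θ : ℝ × ℝ} (hθ : θ ∈ U) :
    HasFDerivAt (expIntegral ν X Y F)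
      (expIntegral ν X Y (fun s => X s * F s) θ • ContinuousLinearMap.fst ℝ ℝ ℝ +
        expIntegral ν X Y (fun s => Y s * F s) θ • ContinuousLinearMap.snd ℝ ℝ ℝ) θ := by
  have hXF := hF.mul_left hX hY hFm hU
  have hYF := hF.mul_right hX hY hFm hU
  obtain ⟨r₁, hr₁, -, hint₁⟩ := hXF.exists_cornerSum hU hθ
  obtain ⟨r₂, hr₂, -, hint₂⟩ := hYF.exists_cornerSum hU hθ
  set F' : ℝ × ℝ → Ω → (ℝ × ℝ →L[ℝ] ℝ) := fun θ s =>
    (X s * F s * Real.exp (θ.1 * X s + θ.2 * Y s)) • ContinuousLinearMap.fst ℝ ℝ ℝ +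
    (Y s * F s * Real.exp (θ.1 * X s + θ.2 * Y s)) • ContinuousLinearMap.snd ℝ ℝ ℝ with hF'
  have hval : ∫ s, F' θ s ∂ν =
      expIntegral ν X Y (fun s => X s * F s) θ • ContinuousLinearMap.fst ℝ ℝ ℝ +
        expIntegral ν X Y (fun s => Y s * F s) θ • ContinuousLinearMap.snd ℝ ℝ ℝ := by
    simp only [hF', expIntegral]
    rw [integral_add ((hXF θ hθ).smul_const _) ((hYF θ hθ).smul_const _),
      integral_smul_const, integral_smul_const]
  have hF'int : Integrable (F' θ) ν :=
    ((hXF θ hθ).smul_const (ContinuousLinearMap.fst ℝ ℝ ℝ)).add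
      ((hYF θ hθ).smul_const (ContinuousLinearMap.snd ℝ ℝ ℝ))
  rw [← hval]
  refine hasFDerivAt_integral_of_dominated_of_fderiv_le (𝕜 := ℝ)
    (F' := F') (F := fun θ s => F s * Real.exp (θ.1 * X s + θ.2 * Y s))
    (s := Metric.closedBall θ r₁ ∩ Metric.closedBall θ r₂)
    (bound := fun s => ‖X s * F s * cornerSum θ r₁ (X s) (Y s)‖ +
      ‖Y s * F s * cornerSum θ r₂ (X s) (Y s)‖)
    (inter_mem (Metric.closedBall_mem_nhds _ hr₁) (Metric.closedBall_mem_nhds _ hr₂))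
    (Eventually.of_forall fun _ => by fun_prop) (hF θ hθ)
    hF'int.aestronglyMeasurable
    (ae_of_all _ fun s η hη => ?_) (hint₁.norm.add hint₂.norm) (ae_of_all _ fun s η _ => ?_)
  · have hc₁ : 0 ≤ cornerSum θ r₁ (X s) (Y s) := by unfold cornerSum; positivity
    have hc₂ : 0 ≤ cornerSum θ r₂ (X s) (Y s) := by unfold cornerSum; positivity
    refine (norm_add_le _ _).trans (add_le_add ?_ ?_)
    · rw [norm_smul, norm_mul, norm_mul _ (cornerSum _ _ _ _)]
      refine (mul_le_of_le_one_right (by positivity) (ContinuousLinearMap.norm_fst_le ..)).trans ?_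
      rw [Real.norm_of_nonneg hc₁, Real.norm_of_nonneg (Real.exp_pos _).le]
      exact mul_le_mul_of_nonneg_left (exp_le_cornerSum hη.1) (norm_nonneg _)
    · rw [norm_smul, norm_mul, norm_mul _ (cornerSum _ _ _ _)]
      refine (mul_le_of_le_one_right (by positivity) (ContinuousLinearMap.norm_snd_le ..)).trans ?_
      rw [Real.norm_of_nonneg hc₂, Real.norm_of_nonneg (Real.exp_pos _).le]
      exact mul_le_mul_of_nonneg_left (exp_le_cornerSum hη.2) (norm_nonneg _)
  · have h1 : HasFDerivAt (fun θ : ℝ × ℝ => θ.1 * X s + θ.2 * Y s)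
        (X s • ContinuousLinearMap.fst ℝ ℝ ℝ + Y s • ContinuousLinearMap.snd ℝ ℝ ℝ) η :=
      (hasFDerivAt_fst.mul_const (X s)).add (hasFDerivAt_snd.mul_const (Y s))
    refine (h1.exp.const_mul (F s)).congr_fderiv ?_
    ext <;> simp [hF'] <;> ring

lemma ExpIntegrableOn.contDiffOn (hX : Measurable X) (hY : Measurable Y)
    (hFm : Measurable F) (hU : IsOpen U) (hF : ExpIntegrableOn ν X Y F U) :
    ContDiffOn ℝ (⊤ : ℕ∞) (expIntegral ν X Y F) U := by
  refine contDiffOn_infty.2 fun n => ?_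
  induction n generalizing F with
  | zero =>
    exact contDiffOn_zero.2 fun θ hθ =>
      (hF.hasFDerivAt hX hY hFm hU hθ).continuousAt.continuousWithinAt
  | succ n ih =>
    push_cast
    refine (contDiffOn_succ_iff_hasFDerivWithinAt (by simp)).2 fun θ hθ =>
      ⟨U, by rw [insert_eq_of_mem hθ]; exact self_mem_nhdsWithin, by simp, _,
        fun η hη => (hF.hasFDerivAt hX hY hFm hU hη).hasFDerivWithinAt, ?_⟩
    exact ((ih (hX.mul hFm) (hF.mul_left hX hY hFm hU)).smul contDiffOn_const).add
      ((ih (hY.mul hFm) (hF.mul_right hX hY hFm hU)).smul contDiffOn_const)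

end ParametricExponential

section DecayingSolutions

open Asymptotics

/-- `f` is an eventually positive, rapidly decaying solution of `f'' = (x² - μ) f` on the line,
with derivative `f'`. -/
structure DecayingSolution (μ : ℝ) (f f' : ℝ → ℝ) : Prop where
  deriv : ∀ x, HasDerivAt f (f' x) x
  deriv' : ∀ x, HasDerivAt f' ((x ^ 2 - μ) * f x) x
  decay : SuperpolynomialDecay atTop (fun x : ℝ => x) f
  decay' : SuperpolynomialDecay atTop (fun x : ℝ => x) f'
  pos : ∀ᶠ x in atTop, 0 < f x

namespace DecayingSolution

variable {μ : ℝ} {f f' : ℝ → ℝ}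

lemma continuous (h : DecayingSolution μ f f') : Continuous f :=
  continuous_iff_continuousAt.2 fun x => (h.deriv x).continuousAt

lemma continuous' (h : DecayingSolution μ f f') : Continuous f' :=
  continuous_iff_continuousAt.2 fun x => (h.deriv' x).continuousAt

lemma tendsto_mul_zero {g k : ℝ → ℝ} (hg : SuperpolynomialDecay atTop (fun x : ℝ => x) g)
    (hk : SuperpolynomialDecay atTop (fun x : ℝ => x) k) :
    Tendsto (fun x => g x * k x) atTop (nhds 0) := by
  simpa using (hg 0).mul (hk 0)

/-- A continuous function without zeros on a half-line that is eventually positive is positive. -/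
lemma pos_of_ne_zero (h : DecayingSolution μ f f') {x₀ : ℝ} (hne : ∀ x ≥ x₀, f x ≠ 0) :
    ∀ x ≥ x₀, 0 < f x := by
  intro x hx
  by_contra hcon
  obtain ⟨y, hy, hxy⟩ := (h.pos.and (eventually_ge_atTop x)).exists
  obtain ⟨c, hc, hc0⟩ := intermediate_value_Icc hxy h.continuous.continuousOn
    ⟨not_lt.1 hcon, hy.le⟩
  exact hne c (hx.trans hc.1) hc0

lemma mul_deriv_nonpos (h : DecayingSolution μ f f') {x₁ : ℝ} (hx₁ : 0 ≤ x₁) (hμ : μ ≤ x₁ ^ 2) :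
    ∀ x ≥ x₁, f x * f' x ≤ 0 := by
  have hmono : MonotoneOn (fun x => f x * f' x) (Ici x₁) := by
    refine monotoneOn_of_hasDerivWithinAt_nonneg (convex_Ici _)
      (h.continuous.mul h.continuous').continuousOn
      (fun x _ => ((h.deriv x).mul (h.deriv' x)).hasDerivWithinAt) fun x hx => ?_
    rw [interior_Ici] at hx
    have : 0 ≤ x ^ 2 - μ := by nlinarith [hx.out]
    nlinarith [mul_self_nonneg (f' x), mul_nonneg this (mul_self_nonneg (f x))]
  intro x hx
  refine ge_of_tendsto (tendsto_mul_zero h.decay h.decay') ?_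
  filter_upwards [eventually_ge_atTop x] with y hy using hmono hx (hx.le.trans hy) hy

lemma pos_of_le_sq (h : DecayingSolution μ f f') {x₁ : ℝ} (hx₁ : 0 ≤ x₁) (hμ : μ ≤ x₁ ^ 2) :
    ∀ x ≥ x₁, 0 < f x := by
  have hanti : AntitoneOn (fun x => f x * f x) (Ici x₁) := by
    refine antitoneOn_of_hasDerivWithinAt_nonpos (convex_Ici _)
      (h.continuous.mul h.continuous).continuousOn
      (fun x _ => ((h.deriv x).mul (h.deriv x)).hasDerivWithinAt) fun x hx => ?_
    rw [interior_Ici] at hx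
    linarith [h.mul_deriv_nonpos hx₁ hμ x hx.out.le]
  refine h.pos_of_ne_zero fun x hx hx0 => ?_
  obtain ⟨y, hy, hxy⟩ := (h.pos.and (eventually_ge_atTop x)).exists
  have := hanti hx (hx.le.trans hxy) hxy
  simp only [hx0] at this
  nlinarith

lemma deriv_nonpos_of_le_sq (h : DecayingSolution μ f f') {x₁ : ℝ} (hx₁ : 0 ≤ x₁)
    (hμ : μ ≤ x₁ ^ 2) : ∀ x ≥ x₁, f' x ≤ 0 := fun x hx =>
  nonpos_of_mul_nonpos_right (h.mul_deriv_nonpos hx₁ hμ x hx) (h.pos_of_le_sq hx₁ hμ x hx)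

lemma exists_le_sq (μ : ℝ) : ∃ x₁ : ℝ, 0 ≤ x₁ ∧ μ ≤ x₁ ^ 2 :=
  ⟨|μ| + 1, by positivity, by nlinarith [le_abs_self μ, abs_nonneg μ]⟩

/-- The raising operator `x - d/dx` of the harmonic oscillator. -/
lemma raise (h : DecayingSolution μ f f') :
    DecayingSolution (μ + 2) (fun x => x * f x - f' x)
      (fun x => x * f' x - (x ^ 2 - μ - 1) * f x) where
  deriv x := by
    convert! ((hasDerivAt_id x).mul (h.deriv x)).sub (h.deriv' x) using 1
    simp only [id]; ring
  deriv' x := by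
    have h2 : HasDerivAt (fun x : ℝ => x ^ 2 - μ - 1) (2 * x) x := by
      simpa using (((hasDerivAt_id x).pow 2).sub_const μ).sub_const 1
    convert! ((hasDerivAt_id x).mul (h.deriv' x)).sub (h2.mul (h.deriv x)) using 1
    simp only [id]; ring
  decay := (h.decay.param_mul.add (h.decay'.const_mul (-1))).congr fun x => by
    simp only [Pi.add_apply, Pi.mul_apply]; ring
  decay' := ((h.decay'.param_mul.add ((h.decay.param_pow_mul 2).const_mul (-1))).add
      (h.decay.const_mul (μ + 1))).congr fun x => by
    simp only [Pi.add_apply, Pi.mul_apply, Pi.pow_apply]; ring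
  pos := by
    obtain ⟨x₁, hx₁, hμ⟩ := exists_le_sq μ
    filter_upwards [eventually_ge_atTop x₁, eventually_gt_atTop 0] with x hx hx0
    have := h.deriv_nonpos_of_le_sq hx₁ hμ x hx
    have := mul_pos hx0 (h.pos_of_le_sq hx₁ hμ x hx)
    linarith

lemma integrableOn_of_decay {g : ℝ → ℝ} (hg : Continuous g)
    (hgd : SuperpolynomialDecay atTop (fun x : ℝ => x) g) (c : ℝ) :
    IntegrableOn g (Ioi c) := by
  have hO : g =O[atTop] fun x : ℝ => x ^ (-2 : ℝ) := by
    refine ((superpolynomialDecay_iff_isBigO g tendsto_id).1 hgd (-2)).congr_right fun x => ?_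
    rw [show (-2 : ℝ) = ((-2 : ℤ) : ℝ) by norm_num, Real.rpow_intCast]; rfl
  refine IntegrableOn.mono_set ?_ Ioi_subset_Ici_self
  exact (hg.locallyIntegrable.locallyIntegrableOn _).integrableOn_of_isBigO_atTop hO
    (integrableAtFilter_rpow_atTop_iff.2 (by norm_num))

end DecayingSolution

end DecayingSolutions

section BaseSolution

open Asymptotics

/-- `∫₀^∞ G(s) s^p e^{-2 x s} ds` as a function of `(p, x)`. -/
noncomputable def halfLineLaplace (G : ℝ → ℝ) (θ : ℝ × ℝ) : ℝ :=
  expIntegral (volume.restrict (Ioi 0)) Real.log (fun s => -2 * s) G θ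

lemma isOpen_neg_one_lt_fst : IsOpen {θ : ℝ × ℝ | -1 < θ.1} :=
  isOpen_lt continuous_const continuous_fst

lemma exp_mul_log_add (p x : ℝ) {s : ℝ} (hs : 0 < s) :
    Real.exp (p * Real.log s + x * (-2 * s)) = s ^ p * Real.exp (-2 * x * s) := by
  rw [Real.exp_add, Real.rpow_def_of_pos hs, mul_comm p]
  ring_nf

lemma expIntegrableOn_gaussian :
    ExpIntegrableOn (volume.restrict (Ioi 0)) Real.log (fun s => -2 * s)
      (fun s => Real.exp (-s ^ 2)) {θ : ℝ × ℝ | -1 < θ.1} := by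
  intro θ hθ
  have h := (integrableOn_rpow_mul_exp_neg_mul_sq (b := 1 / 2) (by norm_num) hθ).const_mul
    (Real.exp (2 * θ.2 ^ 2))
  refine h.mono (by fun_prop) ?_
  filter_upwards [ae_restrict_mem measurableSet_Ioi] with s hs
  rw [exp_mul_log_add _ _ hs]
  have h1 : Real.exp (-s ^ 2) * Real.exp (-2 * θ.2 * s) ≤
      Real.exp (2 * θ.2 ^ 2) * Real.exp (-(1 / 2) * s ^ 2) := by
    rw [← Real.exp_add, ← Real.exp_add]
    exact Real.exp_le_exp.2 (by nlinarith [sq_nonneg (s + 2 * θ.2)])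
  have hp : 0 ≤ s ^ θ.1 := Real.rpow_nonneg hs.out.le _
  rw [Real.norm_of_nonneg (by positivity), Real.norm_of_nonneg (by positivity)]
  nlinarith [mul_le_mul_of_nonneg_left h1 hp]

lemma ExpIntegrableOn.halfLineLaplace_hasDerivAt {G : ℝ → ℝ} (hGm : Measurable G)
    (hG : ExpIntegrableOn (volume.restrict (Ioi 0)) Real.log (fun s => -2 * s) G
      {θ : ℝ × ℝ | -1 < θ.1}) {p : ℝ} (hp : -1 < p) (x : ℝ) :
    HasDerivAt (fun x => halfLineLaplace G (p, x))
      (halfLineLaplace (fun s => -2 * s * G s) (p, x)) x := by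
  have h := hG.hasFDerivAt Real.measurable_log (by fun_prop) hGm isOpen_neg_one_lt_fst
    (θ := (p, x)) hp
  have hg : HasDerivAt (fun y : ℝ => ((p, y) : ℝ × ℝ)) ((0, 1) : ℝ × ℝ) x :=
    (hasDerivAt_const x p).prodMk (hasDerivAt_id x)
  have hc : HasDerivAt (halfLineLaplace G ∘ fun y : ℝ => ((p, y) : ℝ × ℝ)) _ x :=
    HasFDerivAt.comp_hasDerivAt (f := fun y : ℝ => ((p, y) : ℝ × ℝ)) x h hg
  refine HasDerivAt.congr_deriv hc ?_
  simp [halfLineLaplace]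

lemma ExpIntegrableOn.abs_halfLineLaplace_le {G : ℝ → ℝ}
    (hG : ExpIntegrableOn (volume.restrict (Ioi 0)) Real.log (fun s => -2 * s) G
      {θ : ℝ × ℝ | -1 < θ.1}) {p : ℝ} (hp : -1 < p) {x : ℝ} (hx : 0 ≤ x) :
    |halfLineLaplace G (p, x)| ≤
      ∫ s in Ioi (0 : ℝ), ‖G s * Real.exp (p * Real.log s + 0 * (-2 * s))‖ := by
  rw [← Real.norm_eq_abs, halfLineLaplace, expIntegral]
  refine (norm_integral_le_integral_norm _).trans ?_
  refine setIntegral_mono_on (hG (p, x) hp).norm (hG (p, 0) hp).norm measurableSet_Ioi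
    fun s hs => ?_
  simp only [norm_mul, Real.norm_eq_abs, Real.abs_exp]
  gcongr ?_ * ?_
  exact Real.exp_le_exp.2 (by nlinarith [mul_nonneg hx hs.out.le])

lemma superpolynomialDecay_gaussian_mul {g : ℝ → ℝ} {C : ℝ} (hg : ∀ x ≥ 0, |g x| ≤ C) :
    SuperpolynomialDecay atTop (fun x : ℝ => x) (fun x => Real.exp (-x ^ 2 / 2) * g x) := by
  have h1 : SuperpolynomialDecay atTop (fun x : ℝ => x) (fun x => C * Real.exp (-x)) :=
    SuperpolynomialDecay.const_mul
      (fun n => by simpa using Real.tendsto_pow_mul_exp_neg_atTop_nhds_zero n) C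
  refine h1.trans_eventually_abs_le ?_
  filter_upwards [eventually_ge_atTop 2] with x hx
  have hC : 0 ≤ C := (abs_nonneg _).trans (hg x (by linarith))
  simp only [Function.comp, abs_mul, Real.abs_exp, abs_of_nonneg hC]
  rw [mul_comm]
  exact mul_le_mul (hg x (by linarith)) (Real.exp_le_exp.2 (by nlinarith)) (Real.exp_pos _).le hC

/-- The Hermite equation for the Laplace integral, from integrating a total derivative. -/
lemma halfLineLaplace_hermite {p : ℝ} (hp : -1 < p) (x : ℝ) :
    halfLineLaplace (fun s => -2 * s * (-2 * s * Real.exp (-s ^ 2))) (p, x) -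
      2 * x * halfLineLaplace (fun s => -2 * s * Real.exp (-s ^ 2)) (p, x) -
      2 * (p + 1) * halfLineLaplace (fun s => Real.exp (-s ^ 2)) (p, x) = 0 := by
  have m0 : Measurable fun s : ℝ => Real.exp (-s ^ 2) := by fun_prop
  have m1 : Measurable fun s : ℝ => -2 * s * Real.exp (-s ^ 2) := by fun_prop
  have e0 := expIntegrableOn_gaussian
  have e1 := e0.mul_right Real.measurable_log (by fun_prop) m0 isOpen_neg_one_lt_fst
  have e2 := e1.mul_right Real.measurable_log (by fun_prop) m1 isOpen_neg_one_lt_fst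
  have i0 := (e0 (p, x) hp).const_mul (2 * (p + 1))
  have i1 := (e1 (p, x) hp).const_mul (2 * x)
  have i2 := e2 (p, x) hp
  have hsum := (i2.sub i1).sub i0
  unfold halfLineLaplace expIntegral
  rw [← integral_const_mul, ← integral_const_mul, ← integral_sub' i2 i1,
    ← integral_sub' (i2.sub i1) i0]
  set k : ℝ → ℝ := fun s => -2 * (s ^ (p + 1) * Real.exp (-s ^ 2 - 2 * x * s)) with hk
  have hk0 : k 0 = 0 := by simp [hk, Real.zero_rpow (by linarith : p + 1 ≠ 0)]
  have hcont : ContinuousWithinAt k (Ici 0) 0 := by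
    refine Continuous.continuousWithinAt ?_
    have : Continuous fun s : ℝ => s ^ (p + 1) := Real.continuous_rpow_const (by linarith)
    fun_prop
  have hderiv : ∀ s ∈ Ioi (0 : ℝ), HasDerivAt k
      (-2 * s * (-2 * s * Real.exp (-s ^ 2)) * Real.exp (p * Real.log s + x * (-2 * s)) -
        2 * x * (-2 * s * Real.exp (-s ^ 2) * Real.exp (p * Real.log s + x * (-2 * s))) -
        2 * (p + 1) * (Real.exp (-s ^ 2) * Real.exp (p * Real.log s + x * (-2 * s)))) s := by
    intro s hs
    have d1 : HasDerivAt (fun s : ℝ => s ^ (p + 1)) ((p + 1) * s ^ p) s := by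
      simpa using Real.hasDerivAt_rpow_const (p := p + 1) (Or.inl hs.out.ne')
    have d2 : HasDerivAt (fun s : ℝ => -s ^ 2 - 2 * x * s) (-(2 * s) - 2 * x) s := by
      convert! ((hasDerivAt_id s).pow 2).neg.sub ((hasDerivAt_id s).const_mul (2 * x)) using 1
      simp
    convert! (d1.mul d2.exp).const_mul (-2) using 1
    rw [exp_mul_log_add _ _ hs, Real.rpow_add_one hs.out.ne',
      show -s ^ 2 - 2 * x * s = -s ^ 2 + -2 * x * s by ring, Real.exp_add]
    ring
  have hlim : Tendsto k atTop (nhds 0) := by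
    have h1 := (tendsto_rpow_mul_exp_neg_mul_atTop_nhds_zero (p + 1) 1 one_pos).const_mul
      (2 * Real.exp ((1 - 2 * x) ^ 2 / 4))
    rw [mul_zero] at h1
    refine squeeze_zero_norm' ?_ h1
    filter_upwards [eventually_gt_atTop 0] with s hs
    have h2 : Real.exp (-s ^ 2 - 2 * x * s) ≤
        Real.exp ((1 - 2 * x) ^ 2 / 4) * Real.exp (-1 * s) := by
      rw [← Real.exp_add]
      exact Real.exp_le_exp.2 (by nlinarith [sq_nonneg (s - (1 - 2 * x) / 2)])
    have hp : 0 ≤ s ^ (p + 1) := Real.rpow_nonneg hs.le _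
    simp only [hk, norm_mul, Real.norm_eq_abs, Real.abs_exp, abs_of_nonneg hp]
    rw [abs_neg, abs_two]
    nlinarith [mul_le_mul_of_nonneg_left h2 hp]
  have := integral_Ioi_of_hasDerivAt_of_tendsto hcont hderiv hsum hlim
  rw [hk0, sub_zero] at this
  exact this

lemma halfLineLaplace_gaussian_pos {p : ℝ} (hp : -1 < p) (x : ℝ) :
    0 < halfLineLaplace (fun s => Real.exp (-s ^ 2)) (p, x) := by
  have h := expIntegrableOn_gaussian (p, x) hp
  refine (integral_pos_iff_support_of_nonneg (fun s => by positivity) h).2 ?_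
  have : (Function.support fun s : ℝ => Real.exp (-s ^ 2) *
      Real.exp (p * Real.log s + x * (-2 * s))) = univ := by
    ext s; simp [Real.exp_ne_zero]
  rw [this]
  simp

/-- A family of decaying solutions for all `μ < M`, depending smoothly on `(μ, x)`. -/
structure DecayingFamily (M : ℝ) (ψ ψ' : ℝ → ℝ → ℝ) : Prop where
  smooth : ContDiffOn ℝ (⊤ : ℕ∞) (fun q : ℝ × ℝ => ψ q.1 q.2) (Iio M ×ˢ univ)
  smooth' : ContDiffOn ℝ (⊤ : ℕ∞) (fun q : ℝ × ℝ => ψ' q.1 q.2) (Iio M ×ˢ univ)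
  sol : ∀ μ < M, DecayingSolution μ (ψ μ) (ψ' μ)

lemma decayingSolution_halfLineLaplace {μ : ℝ} (hμ : μ < 1) :
    DecayingSolution μ
      (fun x => Real.exp (-x ^ 2 / 2) *
        halfLineLaplace (fun s => Real.exp (-s ^ 2)) (-(1 + μ) / 2, x))
      (fun x => Real.exp (-x ^ 2 / 2) *
          halfLineLaplace (fun s => -2 * s * Real.exp (-s ^ 2)) (-(1 + μ) / 2, x) -
        x * (Real.exp (-x ^ 2 / 2) *
          halfLineLaplace (fun s => Real.exp (-s ^ 2)) (-(1 + μ) / 2, x))) := by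
  have hp : -1 < -(1 + μ) / 2 := by linarith
  have m0 : Measurable fun s : ℝ => Real.exp (-s ^ 2) := by fun_prop
  have m1 : Measurable fun s : ℝ => -2 * s * Real.exp (-s ^ 2) := by fun_prop
  have e0 := expIntegrableOn_gaussian
  have e1 := e0.mul_right Real.measurable_log (by fun_prop) m0 isOpen_neg_one_lt_fst
  have hexp : ∀ x : ℝ, HasDerivAt (fun x : ℝ => Real.exp (-x ^ 2 / 2))
      (-x * Real.exp (-x ^ 2 / 2)) x := fun x => by
    have : HasDerivAt (fun x : ℝ => -x ^ 2 / 2) (-x) x := by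
      convert! (((hasDerivAt_id x).pow 2).neg).div_const 2 using 1
      simp only [id, Nat.cast_ofNat]; ring
    rw [mul_comm]; exact this.exp
  have dec0 := superpolynomialDecay_gaussian_mul fun x hx =>
    e0.abs_halfLineLaplace_le hp (x := x) hx
  have dec1 := superpolynomialDecay_gaussian_mul fun x hx =>
    e1.abs_halfLineLaplace_le hp (x := x) hx
  have d0 := e0.halfLineLaplace_hasDerivAt m0 hp
  have d1 := e1.halfLineLaplace_hasDerivAt m1 hp
  refine ⟨fun x => ?_, fun x => ?_, dec0, ?_, ?_⟩
  · convert! (hexp x).mul (d0 x) using 1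
    ring
  · convert! ((hexp x).mul (d1 x)).sub ((hasDerivAt_id x).mul ((hexp x).mul (d0 x))) using 1
    simp only [id, Pi.mul_apply]
    linear_combination (-Real.exp (-x ^ 2 / 2)) * halfLineLaplace_hermite hp x
  · refine (dec1.add (dec0.param_mul.const_mul (-1))).congr fun x => ?_
    simp only [Pi.add_apply, Pi.mul_apply]
    ring
  · exact Eventually.of_forall fun x =>
      mul_pos (Real.exp_pos _) (halfLineLaplace_gaussian_pos hp x)

lemma exists_decayingFamily_one : ∃ ψ ψ', DecayingFamily 1 ψ ψ' := by
  have m0 : Measurable fun s : ℝ => Real.exp (-s ^ 2) := by fun_prop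
  have m1 : Measurable fun s : ℝ => -2 * s * Real.exp (-s ^ 2) := by fun_prop
  have e0 := expIntegrableOn_gaussian
  have e1 := e0.mul_right Real.measurable_log (by fun_prop) m0 isOpen_neg_one_lt_fst
  have key : ∀ {G : ℝ → ℝ}, Measurable G →
      ExpIntegrableOn (volume.restrict (Ioi 0)) Real.log (fun s => -2 * s) G
        {θ : ℝ × ℝ | -1 < θ.1} →
      ContDiffOn ℝ (⊤ : ℕ∞) (fun q : ℝ × ℝ => Real.exp (-q.2 ^ 2 / 2) *
        halfLineLaplace G (-(1 + q.1) / 2, q.2)) (Iio 1 ×ˢ univ) := by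
    intro G hG he
    refine ContDiffOn.mul (by fun_prop) ?_
    refine (he.contDiffOn Real.measurable_log (by fun_prop) hG isOpen_neg_one_lt_fst).comp
      (g := halfLineLaplace G) (f := fun q : ℝ × ℝ => (-(1 + q.1) / 2, q.2))
      (ContDiff.contDiffOn (by fun_prop)) fun q hq => ?_
    have : q.1 < 1 := hq.1
    change -1 < -(1 + q.1) / 2
    linarith
  exact ⟨_, _, key m0 e0, (key m1 e1).sub (contDiff_snd.contDiffOn.mul (key m0 e0)),
    fun μ hμ => decayingSolution_halfLineLaplace hμ⟩

lemma DecayingFamily.raise {M : ℝ} {ψ ψ' : ℝ → ℝ → ℝ} (h : DecayingFamily M ψ ψ') :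
    DecayingFamily (M + 2) (fun μ x => x * ψ (μ - 2) x - ψ' (μ - 2) x)
      (fun μ x => x * ψ' (μ - 2) x - (x ^ 2 - (μ - 2) - 1) * ψ (μ - 2) x) := by
  have hshift : ContDiffOn ℝ (⊤ : ℕ∞) (fun q : ℝ × ℝ => (q.1 - 2, q.2)) (Iio (M + 2) ×ˢ univ) :=
    ContDiff.contDiffOn (by fun_prop)
  have hmaps : MapsTo (fun q : ℝ × ℝ => (q.1 - 2, q.2)) (Iio (M + 2) ×ˢ univ)
      (Iio M ×ˢ univ) := fun q hq => by
    have : q.1 < M + 2 := hq.1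
    exact ⟨by simp only [mem_Iio]; linarith, mem_univ _⟩
  have s := h.smooth.comp hshift hmaps
  have s' := h.smooth'.comp hshift hmaps
  refine ⟨(contDiff_snd.contDiffOn.mul s).sub s', (contDiff_snd.contDiffOn.mul s').sub
    (ContDiffOn.mul (ContDiff.contDiffOn (by fun_prop)) s), fun μ hμ => ?_⟩
  simpa using (h.sol (μ - 2) (by linarith)).raise

lemma exists_decayingFamily (M : ℝ) : ∃ N > M, ∃ ψ ψ', DecayingFamily N ψ ψ' := by
  obtain ⟨n, hn⟩ := exists_nat_gt M
  have : ∀ n : ℕ, ∃ ψ ψ', DecayingFamily (1 + 2 * n) ψ ψ' := fun n => by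
    induction n with
    | zero => simpa using exists_decayingFamily_one
    | succ n ih =>
      obtain ⟨ψ, ψ', h⟩ := ih
      rw [show (1 : ℝ) + 2 * ((n + 1 : ℕ) : ℝ) = 1 + 2 * n + 2 by push_cast; ring]
      exact ⟨_, _, h.raise⟩
  refine ⟨1 + 2 * n, ?_, this n⟩
  have : (0 : ℝ) ≤ n := n.cast_nonneg
  linarith

end BaseSolution

section LowerBound

/-- Completing the square against a Riccati function `a`. -/
lemma riccati_le {w w' a a' : ℝ → ℝ} {T : ℝ} (hT : 0 ≤ T)
    (hw' : IntervalIntegrable w' volume 0 T)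
    (hw : ∀ t ∈ Icc 0 T, w t = w 0 + ∫ s in (0 : ℝ)..t, w' s)
    (hw2 : IntervalIntegrable (fun t => w' t ^ 2) volume 0 T)
    (ha : ∀ t ∈ Icc 0 T, HasDerivAt a (a' t) t) (ha' : ContinuousOn a' (Icc 0 T)) :
    a T * w T ^ 2 - a 0 * w 0 ^ 2 ≤
      ∫ t in (0 : ℝ)..T, (w' t ^ 2 + (a' t + a t ^ 2) * w t ^ 2) := by
  have hI : uIcc 0 T = Icc 0 T := uIcc_of_le hT
  have ha'i : IntervalIntegrable a' volume 0 T := (hI ▸ ha').intervalIntegrable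
  have hA : ∀ t ∈ Icc 0 T, a t = a 0 + ∫ s in (0 : ℝ)..t, a' s := fun t ht => by
    have hsub : uIcc 0 t ⊆ uIcc 0 T := by
      rw [hI, uIcc_of_le ht.1]; exact Icc_subset_Icc_right ht.2
    rw [intervalIntegral.integral_eq_sub_of_hasDerivAt
      (fun x hx => ha x (hI ▸ hsub hx)) (ha'i.mono_set hsub)]
    ring
  have hprim : ∀ {g : ℝ → ℝ} (c : ℝ), IntervalIntegrable g volume 0 T →
      AbsolutelyContinuousOnInterval (fun t => c + ∫ s in (0 : ℝ)..t, g s) 0 T := fun c hg =>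
    ((LipschitzWith.const c).lipschitzOnWith.absolutelyContinuousOnInterval).fun_add
      (hg.absolutelyContinuousOnInterval_intervalIntegral left_mem_uIcc)
  set A : ℝ → ℝ := fun t => a 0 + ∫ s in (0 : ℝ)..t, a' s with hAdef
  set V : ℝ → ℝ := fun t => w 0 + ∫ s in (0 : ℝ)..t, w' s with hVdef
  have hAac : AbsolutelyContinuousOnInterval A 0 T := hprim (a 0) ha'i
  have hVac : AbsolutelyContinuousOnInterval V 0 T := hprim (w 0) hw'
  have hac := hAac.fun_mul (hVac.fun_mul hVac)
  have h0 : (0 : ℝ) ∈ Icc 0 T := ⟨le_rfl, hT⟩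
  have hT' : T ∈ Icc 0 T := ⟨hT, le_rfl⟩
  have hwc : ContinuousOn w (uIcc 0 T) := hVac.continuousOn.congr fun t ht => hw t (hI ▸ ht)
  have hac' : ContinuousOn a (uIcc 0 T) := fun t ht => (ha t (hI ▸ ht)).continuousAt.continuousWithinAt
  calc a T * w T ^ 2 - a 0 * w 0 ^ 2 = ∫ t in (0 : ℝ)..T, deriv (fun t => A t * (V t * V t)) t := by
        rw [hac.integral_deriv_eq_sub, hA T hT', hw T hT', hA 0 h0, hw 0 h0]
        simp only [hAdef, hVdef]
        simp
        ring
    _ ≤ _ := by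
      refine intervalIntegral.integral_mono_ae_restrict hT hac.intervalIntegrable_deriv
        (hw2.add (ContinuousOn.intervalIntegrable ?_)) ?_
      · exact ((hI ▸ ha').add (hac'.pow 2)).mul (hwc.pow 2)
      · rw [EventuallyLE, ae_restrict_iff' measurableSet_Icc]
        filter_upwards [hw'.ae_hasDerivAt_integral, ha'i.ae_hasDerivAt_integral] with t h1 h2 ht
        have d1 : HasDerivAt V (w' t) t := (h1 (hI ▸ ht) 0 left_mem_uIcc).const_add _
        have d2 : HasDerivAt A (a' t) t := (h2 (hI ▸ ht) 0 left_mem_uIcc).const_add _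
        rw [(d2.fun_mul (d1.fun_mul d1)).deriv, ← show a t = A t from hA t ht,
          ← show w t = V t from hw t ht]
        nlinarith [sq_nonneg (w' t - a t * w t)]

variable {u u' : ℝ → ℂ} {a a' : ℝ → ℝ} {γ ξ μ : ℝ}

namespace AdmissibleHL

lemma continuousOn_Icc (hu : AdmissibleHL u u') {T : ℝ} : ContinuousOn u (Icc 0 T) :=
  hu.cont.mono Icc_subset_Ici_self

lemma integrableOn_potential (hu : AdmissibleHL u u') (ξ : ℝ) :
    IntegrableOn (fun t => (t - ξ) ^ 2 * ‖u t‖ ^ 2) (Ioi 0) := by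
  have h := (hu.memL2t.const_mul 2).add (hu.memL2.const_mul (2 * ξ ^ 2))
  refine h.mono ?_ (ae_of_all _ fun t => ?_)
  · exact ContinuousOn.aestronglyMeasurable (ContinuousOn.mul (by fun_prop)
      ((hu.cont.mono Ioi_subset_Ici_self).norm.pow 2)) measurableSet_Ioi
  · simp only [Pi.add_apply]
    rw [Real.norm_of_nonneg (by positivity), Real.norm_of_nonneg (by positivity)]
    nlinarith [mul_nonneg (sq_nonneg (t + ξ)) (sq_nonneg ‖u t‖)]

lemma riccati_norm_le (hu : AdmissibleHL u u') {T : ℝ} (hT : 0 ≤ T)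
    (ha : ∀ t ∈ Icc 0 T, HasDerivAt a (a' t) t) (ha' : ContinuousOn a' (Icc 0 T)) :
    a T * ‖u T‖ ^ 2 - a 0 * ‖u 0‖ ^ 2 ≤
      ∫ t in (0 : ℝ)..T, (‖u' t‖ ^ 2 + (a' t + a t ^ 2) * ‖u t‖ ^ 2) := by
  have hint : ∀ t ∈ Icc 0 T, IntervalIntegrable u' volume 0 t := fun t ht => hu.locInt t ht.1
  have hu'2 : IntervalIntegrable (fun t => ‖u' t‖ ^ 2) volume 0 T :=
    (intervalIntegrable_iff_integrableOn_Ioc_of_le hT).2 (hu.memL2'.mono_set Ioc_subset_Ioi_self)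
  have hsplit : ∀ z : ℂ, ‖z‖ ^ 2 = z.re ^ 2 + z.im ^ 2 := fun z => by
    rw [← Complex.normSq_eq_norm_sq, Complex.normSq_apply]; ring
  have hT' : T ∈ Icc 0 T := ⟨hT, le_rfl⟩
  have hi := hint T hT'
  have hre' : IntervalIntegrable (fun t => (u' t).re) volume 0 T :=
    ⟨hi.1.re, hi.2.re⟩
  have him' : IntervalIntegrable (fun t => (u' t).im) volume 0 T :=
    ⟨hi.1.im, hi.2.im⟩
  have hre2 : IntervalIntegrable (fun t => (u' t).re ^ 2) volume 0 T := by
    refine hu'2.mono_fun (by rw [uIoc_of_le hT]; exact hre'.1.aestronglyMeasurable.pow 2)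
      (ae_of_all _ fun t => ?_)
    dsimp only
    rw [Real.norm_of_nonneg (by positivity), Real.norm_of_nonneg (by positivity), hsplit]
    nlinarith [sq_nonneg (u' t).im]
  have him2 : IntervalIntegrable (fun t => (u' t).im ^ 2) volume 0 T := by
    refine hu'2.mono_fun (by rw [uIoc_of_le hT]; exact him'.1.aestronglyMeasurable.pow 2)
      (ae_of_all _ fun t => ?_)
    dsimp only
    rw [Real.norm_of_nonneg (by positivity), Real.norm_of_nonneg (by positivity), hsplit]
    nlinarith [sq_nonneg (u' t).re]
  have hre : ∀ t ∈ Icc 0 T, (u t).re = (u 0).re + ∫ s in (0 : ℝ)..t, (u' s).re := fun t ht => by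
    have := Complex.reCLM.intervalIntegral_comp_comm (hint t ht)
    simp only [Complex.reCLM_apply] at this
    rw [hu.ac t ht.1, this, Complex.add_re]
  have him : ∀ t ∈ Icc 0 T, (u t).im = (u 0).im + ∫ s in (0 : ℝ)..t, (u' s).im := fun t ht => by
    have := Complex.imCLM.intervalIntegral_comp_comm (hint t ht)
    simp only [Complex.imCLM_apply] at this
    rw [hu.ac t ht.1, this, Complex.add_im]
  have hI : uIcc 0 T = Icc 0 T := uIcc_of_le hT
  have hb : ContinuousOn (fun t => a' t + a t ^ 2) (Icc 0 T) :=
    ha'.add (ContinuousOn.pow (fun t ht => (ha t ht).continuousAt.continuousWithinAt) 2)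
  have hcre : ContinuousOn (fun t => (u t).re) (Icc 0 T) :=
    Complex.continuous_re.comp_continuousOn hu.continuousOn_Icc
  have hcim : ContinuousOn (fun t => (u t).im) (Icc 0 T) :=
    Complex.continuous_im.comp_continuousOn hu.continuousOn_Icc
  have i1 := hre2.add (ContinuousOn.intervalIntegrable (hI.symm ▸ hb.mul (hcre.pow 2)))
  have i2 := him2.add (ContinuousOn.intervalIntegrable (hI.symm ▸ hb.mul (hcim.pow 2)))
  have h := add_le_add (riccati_le hT hre' hre hre2 ha ha') (riccati_le hT him' him him2 ha ha')
  refine le_trans (le_of_eq ?_) (h.trans (le_of_eq ?_))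
  · simp only [hsplit]; ring
  · refine (intervalIntegral.integral_add i1 i2).symm.trans ?_
    refine intervalIntegral.integral_congr fun t _ => ?_
    simp only [hsplit, Pi.mul_apply, Pi.pow_apply]
    ring

/-- A Riccati supersolution bounds the quadratic form from below. -/
lemma mul_le_qform (hu : AdmissibleHL u u') {C : ℝ}
    (ha : ∀ t ≥ 0, HasDerivAt a (a' t) t) (ha' : ContinuousOn a' (Ici 0))
    (hric : ∀ t ≥ 0, a' t + a t ^ 2 ≤ (t - ξ) ^ 2 - μ) (h0 : a 0 ≤ γ)
    (hinf : ∀ᶠ t in atTop, -C * (1 + t ^ 2) ≤ a t) :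
    μ * ∫ t in Ioi (0 : ℝ), ‖u t‖ ^ 2 ≤ qform γ ξ u u' := by
  have hq : IntegrableOn (fun t => ‖u' t‖ ^ 2 + (t - ξ) ^ 2 * ‖u t‖ ^ 2) (Ioi 0) :=
    hu.memL2'.add (hu.integrableOn_potential ξ)
  have hF : IntegrableOn
      (fun t => ‖u' t‖ ^ 2 + (t - ξ) ^ 2 * ‖u t‖ ^ 2 - μ * ‖u t‖ ^ 2) (Ioi 0) :=
    hq.sub (hu.memL2.const_mul μ)
  have hlim := intervalIntegral_tendsto_integral_Ioi 0 hF tendsto_id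
  rw [integral_sub hq (hu.memL2.const_mul μ), integral_const_mul] at hlim
  unfold qform
  set I := ∫ t in Ioi (0 : ℝ), (‖u' t‖ ^ 2 + (t - ξ) ^ 2 * ‖u t‖ ^ 2)
  set J := ∫ t in Ioi (0 : ℝ), ‖u t‖ ^ 2
  by_contra hcon
  set δ := (-(γ * ‖u 0‖ ^ 2) - (I - μ * J)) / 2 with hδ
  have hδ0 : 0 < δ := by rw [hδ]; linarith
  have hev := hlim.eventually (gt_mem_nhds (show I - μ * J < I - μ * J + δ by linarith))
  have hbig : ∀ᶠ T in atTop, δ ≤ C * (‖u T‖ ^ 2 + T ^ 2 * ‖u T‖ ^ 2) := by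
    filter_upwards [hev, hinf, eventually_ge_atTop 0] with T hT1 hT2 hT
    have h1 := hu.riccati_norm_le hT (fun t ht => ha t ht.1) (ha'.mono Icc_subset_Ici_self)
    have h2 : ∫ t in (0 : ℝ)..T, (‖u' t‖ ^ 2 + (a' t + a t ^ 2) * ‖u t‖ ^ 2) ≤
        ∫ t in (0 : ℝ)..T, (‖u' t‖ ^ 2 + (t - ξ) ^ 2 * ‖u t‖ ^ 2 - μ * ‖u t‖ ^ 2) := by
      refine intervalIntegral.integral_mono_on hT ?_ ?_ fun t ht => ?_
      · refine ((intervalIntegrable_iff_integrableOn_Ioc_of_le hT).2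
          (hu.memL2'.mono_set Ioc_subset_Ioi_self)).add (ContinuousOn.intervalIntegrable ?_)
        rw [uIcc_of_le hT]
        exact ((ha'.mono Icc_subset_Ici_self).add (ContinuousOn.pow
          (fun t ht => (ha t ht.1).continuousAt.continuousWithinAt) 2)).mul
          (hu.continuousOn_Icc.norm.pow 2)
      · exact (intervalIntegrable_iff_integrableOn_Ioc_of_le hT).2
          (hF.mono_set Ioc_subset_Ioi_self)
      · nlinarith [mul_le_mul_of_nonneg_right (hric t ht.1) (sq_nonneg ‖u t‖)]
    have h3 := mul_le_mul_of_nonneg_right hT2 (sq_nonneg ‖u T‖)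
    have h4 := mul_le_mul_of_nonneg_right h0 (sq_nonneg ‖u 0‖)
    simp only [id] at hT1
    nlinarith
  obtain ⟨M, hM⟩ := eventually_atTop.1 (hbig.and (eventually_ge_atTop 0))
  have hint : IntegrableOn (fun t => C * (‖u t‖ ^ 2 + t ^ 2 * ‖u t‖ ^ 2)) (Ioi M) :=
    IntegrableOn.mono_set (Integrable.const_mul (hu.memL2.add hu.memL2t) C)
      (Ioi_subset_Ioi (hM M le_rfl).2)
  have hc : IntegrableOn (fun _ : ℝ => δ) (Ioi M) := by
    refine Integrable.mono hint (by fun_prop) ?_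
    filter_upwards [ae_restrict_mem measurableSet_Ioi] with t ht
    have := (hM t ht.out.le).1
    rwa [Real.norm_of_nonneg hδ0.le, Real.norm_of_nonneg (hδ0.le.trans this)]
  rcases (integrableOn_const_iff (by simp)).1 hc with h | h
  · exact hδ0.ne' (by simpa using h)
  · simp at h

lemma integral_norm_sq_pos (hu : AdmissibleHL u u') (hne : ∃ t ∈ Ici (0 : ℝ), u t ≠ 0) :
    0 < ∫ t in Ioi (0 : ℝ), ‖u t‖ ^ 2 := by
  refine lt_of_le_of_ne (by positivity) fun h => ?_
  obtain ⟨t, ht, htne⟩ := hne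
  have h1 := (integral_eq_zero_iff_of_nonneg (fun _ => by positivity) hu.memL2).1 h.symm
  rw [Measure.restrict_congr_set Ioi_ae_eq_Ici] at h1
  have h2 := Measure.eqOn_of_ae_eq h1 (hu.cont.norm.pow 2) continuousOn_const
    (by rw [interior_Ici, closure_Ioi]) ht
  exact htne (by simpa using h2)

end AdmissibleHL

end LowerBound

section Bounds

variable {μ : ℝ} {f f' : ℝ → ℝ} {γ ξ c : ℝ}

lemma bddBelow_rayleigh (γ ξ : ℝ) :
    BddBelow { r : ℝ | ∃ u u' : ℝ → ℂ, AdmissibleHL u u' ∧ (∃ t ∈ Ici (0:ℝ), u t ≠ 0) ∧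
      r = qform γ ξ u u' / ∫ t in Ioi (0:ℝ), ‖u t‖ ^ 2 } := by
  refine ⟨-γ ^ 2, ?_⟩
  rintro r ⟨u, u', hu, hne, rfl⟩
  rw [le_div_iff₀ (hu.integral_norm_sq_pos hne)]
  refine hu.mul_le_qform (a := fun _ => -|γ|) (a' := fun _ => 0) (C := |γ|)
    (fun t _ => hasDerivAt_const _ _) continuousOn_const (fun t _ => ?_) (neg_abs_le γ)
    (Eventually.of_forall fun t => ?_)
  · nlinarith [sq_abs γ, sq_nonneg (t - ξ)]
  · nlinarith [abs_nonneg γ, mul_nonneg (abs_nonneg γ) (sq_nonneg t)]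

lemma AdmissibleHL.mu1_le {u u' : ℝ → ℂ} (hu : AdmissibleHL u u')
    (hne : ∃ t ∈ Ici (0 : ℝ), u t ≠ 0)
    (hq : qform γ ξ u u' ≤ μ * ∫ t in Ioi (0 : ℝ), ‖u t‖ ^ 2) : mu1 γ ξ ≤ μ :=
  (csInf_le (bddBelow_rayleigh γ ξ) ⟨u, u', hu, hne, rfl⟩).trans
    ((div_le_iff₀ (hu.integral_norm_sq_pos hne)).2 hq)

namespace DecayingSolution

open Asymptotics

lemma integrableOn_comp_sub {g : ℝ → ℝ} (hg : Continuous g)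
    (hgd : SuperpolynomialDecay atTop (fun x : ℝ => x) g) (c ξ : ℝ) :
    IntegrableOn (fun t => g (t - ξ)) (Ioi c) := by
  have h := integrableOn_of_decay hg hgd (c - ξ)
  rw [← integrable_indicator_iff measurableSet_Ioi] at h ⊢
  refine (h.comp_sub_right ξ).congr (ae_of_all _ fun t => ?_)
  simp [indicator]

lemma hasDerivAt_comp_sub (h : DecayingSolution μ f f') (ξ t : ℝ) :
    HasDerivAt (fun t => f (t - ξ)) (f' (t - ξ)) t := by
  simpa using (h.deriv (t - ξ)).comp_sub_const t ξ

lemma hasDerivAt_comp_sub' (h : DecayingSolution μ f f') (ξ t : ℝ) :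
    HasDerivAt (fun t => f' (t - ξ)) (((t - ξ) ^ 2 - μ) * f (t - ξ)) t := by
  simpa using (h.deriv' (t - ξ)).comp_sub_const t ξ

lemma trial_eq_zero (hc : c = 0 ∨ f (c - ξ) = 0) {t : ℝ} (ht : t ∈ Ioi 0 \ Ioi c) :
    f (max t c - ξ) = 0 := by
  obtain ⟨h1, h2⟩ := ht
  rw [mem_Ioi, not_lt] at h2
  rcases hc with rfl | hc
  · exact absurd h1 (not_lt.2 h2)
  · rwa [max_eq_right h2]

/-- The trial function equal to `f (· - ξ)` on `[c, ∞)` and extended by a constant is admissible if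
`c = 0` or the constant vanishes. -/
lemma admissible (h : DecayingSolution μ f f') (hc : c = 0 ∨ f (c - ξ) = 0) :
    AdmissibleHL (fun t => (f (max t c - ξ) : ℂ))
      (fun t => (((Ioi c).indicator (fun t => f' (t - ξ)) t : ℝ) : ℂ)) := by
  have hcont : Continuous fun t => f (max t c - ξ) := by
    have := h.continuous; fun_prop
  have hint : ∀ a b, IntervalIntegrable ((Ioi c).indicator fun t => f' (t - ξ)) volume a b := by
    intro a b
    have hi : IntervalIntegrable (fun t => f' (t - ξ)) volume a b :=
      (h.continuous'.comp (continuous_sub_right ξ)).intervalIntegrable _ _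
    exact ⟨hi.1.indicator measurableSet_Ioi, hi.2.indicator measurableSet_Ioi⟩
  have key : ∀ {g k : ℝ → ℝ}, IntegrableOn g (Ioi c) → (∀ t ∈ Ioi c, k t = g t) →
      (∀ t ∈ Ioi 0 \ Ioi c, k t = 0) → IntegrableOn k (Ioi 0) := fun hg hk hk0 =>
    (hg.congr_fun (fun t ht => (hk t ht).symm) measurableSet_Ioi).of_forall_sdiff_eq_zero
      measurableSet_Ioi hk0
  have hff : SuperpolynomialDecay atTop (fun x : ℝ => x) (f * f) := h.decay.mul h.decay
  have hff' : SuperpolynomialDecay atTop (fun x : ℝ => x) (f' * f') := h.decay'.mul h.decay'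
  have hmax : ∀ t ∈ Ioi c, f (max t c - ξ) = f (t - ξ) := fun t ht => by
    rw [max_eq_left ht.out.le]
  refine ⟨(Complex.continuous_ofReal.comp hcont).continuousOn, fun t _ =>
      ⟨(hint 0 t).1.ofReal, (hint 0 t).2.ofReal⟩,
    fun t ht => ?_, ?_, ?_, ?_⟩
  · have hFTC := integral_eq_of_hasDerivAt_off_countable_of_le (fun t => f (max t c - ξ))
      ((Ioi c).indicator fun t => f' (t - ξ)) ht (countable_singleton c) hcont.continuousOn
      (fun x hx => ?_) (hint 0 t)
    · rw [intervalIntegral.integral_ofReal, hFTC]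
      push_cast; ring
    · rcases lt_or_gt_of_ne hx.2 with hxc | hxc
      · rw [indicator_of_notMem (by simpa using hxc.le)]
        refine (hasDerivAt_const x (f (c - ξ))).congr_of_eventuallyEq ?_
        filter_upwards [gt_mem_nhds hxc] with y hy
        rw [max_eq_right hy.le]
      · rw [indicator_of_mem (mem_Ioi.2 hxc)]
        refine (h.hasDerivAt_comp_sub ξ x).congr_of_eventuallyEq ?_
        filter_upwards [lt_mem_nhds hxc] with y hy
        rw [max_eq_left hy.le]
  · refine key (integrableOn_comp_sub (h.continuous.mul h.continuous) hff c ξ)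
      (fun t ht => ?_) fun t ht => ?_
    · simp [hmax t ht, sq]
    · simp [trial_eq_zero hc ht]
  · refine key (integrableOn_comp_sub (h.continuous'.mul h.continuous') hff' c ξ)
      (fun t ht => ?_) fun t ht => ?_
    · simp [indicator_of_mem ht, sq]
    · simp [indicator_of_notMem ht.2]
  · have hd : SuperpolynomialDecay atTop (fun x : ℝ => x) (fun x => (x + ξ) ^ 2 * (f * f) x) :=
      (((hff.param_pow_mul 2).add (hff.param_mul.const_mul (2 * ξ))).add
        (hff.const_mul (ξ ^ 2))).congr fun x => by
          simp only [Pi.add_apply, Pi.mul_apply, Pi.pow_apply]; ring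
    refine key (integrableOn_comp_sub (by have := h.continuous; fun_prop) hd c ξ)
      (fun t ht => ?_) fun t ht => ?_
    · simp [hmax t ht, sq]
    · simp [trial_eq_zero hc ht]

lemma qform_trial (h : DecayingSolution μ f f') (hc0 : 0 ≤ c) (hc : c = 0 ∨ f (c - ξ) = 0) (γ : ℝ) :
    qform γ ξ (fun t => (f (max t c - ξ) : ℂ))
      (fun t => (((Ioi c).indicator (fun t => f' (t - ξ)) t : ℝ) : ℂ)) =
    μ * (∫ t in Ioi (0 : ℝ), ‖(f (max t c - ξ) : ℂ)‖ ^ 2) -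
      f (c - ξ) * (f' (c - ξ) - γ * f (c - ξ)) := by
  have hu := h.admissible hc
  set u : ℝ → ℂ := fun t => (f (max t c - ξ) : ℂ) with hudef
  set u' : ℝ → ℂ := fun t => (((Ioi c).indicator (fun t => f' (t - ξ)) t : ℝ) : ℂ) with hu'def
  have hq : IntegrableOn (fun t => ‖u' t‖ ^ 2 + (t - ξ) ^ 2 * ‖u t‖ ^ 2) (Ioi 0) :=
    hu.memL2'.add (hu.integrableOn_potential ξ)
  have hF : IntegrableOn
      (fun t => ‖u' t‖ ^ 2 + (t - ξ) ^ 2 * ‖u t‖ ^ 2 - μ * ‖u t‖ ^ 2) (Ioi 0) :=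
    hq.sub (hu.memL2.const_mul μ)
  have h1 : ∫ t in Ioi (0 : ℝ), (‖u' t‖ ^ 2 + (t - ξ) ^ 2 * ‖u t‖ ^ 2 - μ * ‖u t‖ ^ 2) =
      ∫ t in Ioi c, (‖u' t‖ ^ 2 + (t - ξ) ^ 2 * ‖u t‖ ^ 2 - μ * ‖u t‖ ^ 2) := by
    refine setIntegral_eq_of_subset_of_forall_sdiff_eq_zero measurableSet_Ioi
      (Ioi_subset_Ioi hc0) fun t ht => ?_
    simp [hudef, hu'def, trial_eq_zero hc ht, indicator_of_notMem ht.2]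
  have h2 : ∫ t in Ioi c, (‖u' t‖ ^ 2 + (t - ξ) ^ 2 * ‖u t‖ ^ 2 - μ * ‖u t‖ ^ 2) =
      0 - f (c - ξ) * f' (c - ξ) := by
    have hEq : EqOn (fun t => ‖u' t‖ ^ 2 + (t - ξ) ^ 2 * ‖u t‖ ^ 2 - μ * ‖u t‖ ^ 2)
        (fun t => f' (t - ξ) * f' (t - ξ) + f (t - ξ) * (((t - ξ) ^ 2 - μ) * f (t - ξ)))
        (Ioi c) := fun t ht => by
      simp only [hudef, hu'def, indicator_of_mem ht, max_eq_left ht.out.le, Complex.norm_real,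
        Real.norm_eq_abs, sq_abs]
      ring
    rw [setIntegral_congr_fun measurableSet_Ioi hEq]
    refine integral_Ioi_of_hasDerivAt_of_tendsto' (f := fun t => f (t - ξ) * f' (t - ξ))
      (fun t _ => (h.hasDerivAt_comp_sub ξ t).mul (h.hasDerivAt_comp_sub' ξ t))
      ((hF.mono_set (Ioi_subset_Ioi hc0)).congr_fun hEq measurableSet_Ioi) ?_
    exact (tendsto_mul_zero h.decay h.decay').comp (tendsto_atTop_add_const_right _ (-ξ) tendsto_id)
  rw [h2, integral_sub hq (hu.memL2.const_mul μ), integral_const_mul] at h1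
  have h0 : ‖u 0‖ ^ 2 = f (c - ξ) ^ 2 := by
    simp [hudef, max_eq_right hc0]
  rw [qform, h0]
  linear_combination h1

lemma trial_ne_zero (h : DecayingSolution μ f f') (c ξ : ℝ) :
    ∃ t ∈ Ici (0 : ℝ), (f (max t c - ξ) : ℂ) ≠ 0 := by
  obtain ⟨x, hx, hx0⟩ := (h.pos.and (eventually_ge_atTop (max 0 c - ξ))).exists
  have h1 : max 0 c ≤ x + ξ := by linarith
  refine ⟨x + ξ, (le_max_left _ _).trans h1, ?_⟩
  rw [max_eq_left ((le_max_right _ _).trans h1), add_sub_cancel_right]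
  exact_mod_cast hx.ne'

lemma mu1_le_of_eq_zero (h : DecayingSolution μ f f') (γ : ℝ) {x : ℝ} (hx : -ξ ≤ x)
    (hx0 : f x = 0) : mu1 γ ξ ≤ μ := by
  have hc : f (x + ξ - ξ) = 0 := by rwa [add_sub_cancel_right]
  have hc0 : 0 ≤ x + ξ := by linarith
  refine (h.admissible (Or.inr hc)).mu1_le (h.trial_ne_zero _ _) (le_of_eq ?_)
  rw [h.qform_trial hc0 (Or.inr hc), hc]
  ring

lemma mu1_le_of_nonneg (h : DecayingSolution μ f f')
    (hb : 0 ≤ f (-ξ) * (f' (-ξ) - γ * f (-ξ))) : mu1 γ ξ ≤ μ := by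
  refine (h.admissible (c := 0) (ξ := ξ) (Or.inl rfl)).mu1_le (h.trial_ne_zero _ _) ?_
  rw [h.qform_trial le_rfl (Or.inl rfl), zero_sub]
  linarith

lemma eventually_neg_le_div (h : DecayingSolution μ f f') (ξ : ℝ) :
    ∃ C, ∀ᶠ t in atTop, -C * (1 + t ^ 2) ≤ f' (t - ξ) / f (t - ξ) := by
  obtain ⟨x₁, hx₁, hμ⟩ := exists_le_sq μ
  refine ⟨3 + 2 * (1 - ξ) ^ 2 + |μ|, ?_⟩
  filter_upwards [eventually_ge_atTop (x₁ + ξ)] with t ht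
  set x := t - ξ with hx
  have hx1 : x₁ ≤ x := by linarith
  have hp := h.pos_of_le_sq hx₁ hμ
  have hanti : ∀ y ≥ x, f y ≤ f x := fun y hy => by
    refine antitoneOn_of_hasDerivWithinAt_nonpos (convex_Ici x) h.continuous.continuousOn
      (fun z _ => (h.deriv z).hasDerivWithinAt) (fun z hz => ?_) self_mem_Ici hy hy
    rw [interior_Ici] at hz
    exact h.deriv_nonpos_of_le_sq hx₁ hμ z (hx1.trans hz.out.le)
  obtain ⟨y, hy, hy'⟩ := exists_hasDerivAt_eq_slope f f' (lt_add_one x)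
    h.continuous.continuousOn fun z _ => h.deriv z
  obtain ⟨z, hz, hz'⟩ := exists_hasDerivAt_eq_slope f' _ hy.1
    h.continuous'.continuousOn fun z _ => h.deriv' z
  rw [add_sub_cancel_left, div_one] at hy'
  rw [eq_div_iff (by linarith [hy.1])] at hz'
  have hfx := hp x hx1
  have hK : (z ^ 2 - μ) * f z * (y - x) ≤ ((x + 1) ^ 2 + |μ|) * f x := by
    have h1 : z ^ 2 - μ ≤ (x + 1) ^ 2 + |μ| := by
      nlinarith [neg_abs_le μ, hz.1, hz.2, hy.2]
    have h2 := hanti z hz.1.le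
    have h3 := hp z (hx1.trans hz.1.le)
    have h4 : (z ^ 2 - μ) * f z ≤ ((x + 1) ^ 2 + |μ|) * f x :=
      mul_le_mul h1 h2 h3.le (by positivity)
    have h5 : 0 ≤ ((x + 1) ^ 2 + |μ|) * f x := by positivity
    have h6 : y - x ≤ 1 := by linarith [hy.2]
    have h7 : 0 ≤ y - x := by linarith [hy.1]
    nlinarith [mul_le_mul_of_nonneg_right h4 h7]
  have h8 := hp (x + 1) (by linarith)
  rw [le_div_iff₀ hfx]
  have h9 : 1 + (x + 1) ^ 2 + |μ| ≤ (3 + 2 * (1 - ξ) ^ 2 + |μ|) * (1 + t ^ 2) := by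
    have := abs_nonneg μ
    have e1 : (x + 1) ^ 2 ≤ 2 * t ^ 2 + 2 * (1 - ξ) ^ 2 := by
      rw [hx]; nlinarith [sq_nonneg (t - (1 - ξ))]
    nlinarith [mul_nonneg this (sq_nonneg t), mul_nonneg (sq_nonneg (1 - ξ)) (sq_nonneg t),
      sq_nonneg t]
  nlinarith [mul_le_mul_of_nonneg_right h9 hfx.le]

lemma le_mu1 (h : DecayingSolution μ f f') (hpos : ∀ x ≥ -ξ, 0 < f x)
    (hb : f' (-ξ) ≤ γ * f (-ξ)) : μ ≤ mu1 γ ξ := by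
  have hp : ∀ t ≥ 0, 0 < f (t - ξ) := fun t ht => hpos _ (by linarith)
  obtain ⟨C, hC⟩ := h.eventually_neg_le_div ξ
  refine le_csInf ⟨_, _, _, h.admissible (c := 0) (ξ := ξ) (Or.inl rfl), h.trial_ne_zero _ _, rfl⟩ ?_
  rintro r ⟨u, u', hu, hne, rfl⟩
  rw [le_div_iff₀ (hu.integral_norm_sq_pos hne)]
  have hc := h.continuous
  have hc' := h.continuous'
  refine hu.mul_le_qform (a := fun t => f' (t - ξ) / f (t - ξ))
    (a' := fun t => (t - ξ) ^ 2 - μ - (f' (t - ξ) / f (t - ξ)) ^ 2) (fun t ht => ?_) ?_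
    (fun t _ => by simp) ?_ hC
  · have := (hp t ht).ne'
    refine ((h.hasDerivAt_comp_sub' ξ t).fun_div (h.hasDerivAt_comp_sub ξ t) this).congr_deriv ?_
    field_simp
  · refine ContinuousOn.sub (by fun_prop) (ContinuousOn.pow (ContinuousOn.div (by fun_prop)
      (by fun_prop) fun t ht => (hp t ht).ne') 2)
  · rw [zero_sub]
    exact (div_le_iff₀ (hpos (-ξ) le_rfl)).2 hb

end DecayingSolution

end Bounds

/-! ### The ground state energy as a root of the boundary condition -/

namespace DecayingSolution

variable {μ : ℝ} {f f' : ℝ → ℝ}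

/-- Uniqueness for the Cauchy problem: a decaying solution has no double zero. -/
lemma deriv_ne_zero_of_eq_zero (h : DecayingSolution μ f f') {c : ℝ} (hc : f c = 0) :
    f' c ≠ 0 := by
  intro hc'
  obtain ⟨d, hd, hcd⟩ := (h.pos.and (eventually_ge_atTop c)).exists
  set L := 1 + c ^ 2 + d ^ 2 + |μ| with hL
  have hder : ∀ x, HasDerivAt (fun x => (f x * f x + f' x * f' x) * Real.exp (-L * x))
      ((f' x * f x + f x * f' x +
        ((x ^ 2 - μ) * f x * f' x + f' x * ((x ^ 2 - μ) * f x))) * Real.exp (-L * x) +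
        (f x * f x + f' x * f' x) * (Real.exp (-L * x) * -L)) x := fun x => by
    have he : HasDerivAt (fun x : ℝ => Real.exp (-L * x)) (Real.exp (-L * x) * -L) x := by
      simpa using ((hasDerivAt_id x).const_mul (-L)).exp
    exact (((h.deriv x).mul (h.deriv x)).add ((h.deriv' x).mul (h.deriv' x))).mul he
  have hanti : AntitoneOn (fun x => (f x * f x + f' x * f' x) * Real.exp (-L * x)) (Icc c d) := by
    refine antitoneOn_of_hasDerivWithinAt_nonpos (convex_Icc c d)
      (fun x _ => (hder x).continuousAt.continuousWithinAt)
      (fun x _ => (hder x).hasDerivWithinAt) fun x hx => ?_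
    rw [interior_Icc] at hx
    have hx2 : x ^ 2 ≤ c ^ 2 + d ^ 2 := by
      rcases le_total 0 x with h0 | h0
      · nlinarith [hx.2, sq_nonneg c]
      · nlinarith [hx.1, sq_nonneg d]
    have hb : |1 + x ^ 2 - μ| ≤ L := by
      rw [abs_le]
      constructor <;> nlinarith [neg_abs_le μ, le_abs_self μ, sq_nonneg x]
    have hmain : 2 * (1 + x ^ 2 - μ) * (f x * f' x) ≤ L * (f x * f x + f' x * f' x) := by
      obtain ⟨h1, h2⟩ := abs_le.1 hb
      nlinarith [mul_nonneg (by linarith : 0 ≤ L - (1 + x ^ 2 - μ)) (sq_nonneg (f x + f' x)),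
        mul_nonneg (by linarith : 0 ≤ L + (1 + x ^ 2 - μ)) (sq_nonneg (f x - f' x))]
    nlinarith [mul_nonneg (sub_nonneg.2 hmain) (Real.exp_pos (-L * x)).le]
  have := hanti (left_mem_Icc.2 hcd) (right_mem_Icc.2 hcd) hcd
  simp only [hc, hc', mul_zero, add_zero, zero_mul] at this
  have h2 : 0 < (f d * f d + f' d * f' d) * Real.exp (-L * d) :=
    mul_pos (by nlinarith [mul_self_nonneg (f' d)]) (Real.exp_pos _)
  linarith

lemma pos_of_nonneg (h : DecayingSolution μ f f') {γ x₀ : ℝ} (hnn : ∀ x ≥ x₀, 0 ≤ f x)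
    (hb : f' x₀ ≤ γ * f x₀) : ∀ x ≥ x₀, 0 < f x := by
  refine h.pos_of_ne_zero fun c hc hc0 => h.deriv_ne_zero_of_eq_zero hc0 ?_
  rcases hc.lt_or_eq with hlt | rfl
  · refine IsLocalMin.hasDerivAt_eq_zero ?_ (h.deriv c)
    filter_upwards [Ioi_mem_nhds hlt] with x hx
    rw [hc0]
    exact hnn x hx.le
  · rw [hc0, mul_zero] at hb
    refine le_antisymm hb (ge_of_tendsto
      ((hasDerivWithinAt_iff_tendsto_slope' (s := Ioi x₀) (by simp)).1
        (h.deriv x₀).hasDerivWithinAt) ?_)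
    filter_upwards [self_mem_nhdsWithin] with x hx
    rw [slope_def_field, hc0, sub_zero]
    exact div_nonneg (hnn x (le_of_lt hx)) (sub_nonneg.2 (le_of_lt hx))

/-- Lower bound on the Wronskian of two positive decaying solutions. -/
lemma le_wronskian {μ₀ μ₁ κ x₀ : ℝ} {f₀ f₀' f₁ f₁' : ℝ → ℝ} (h₀ : DecayingSolution μ₀ f₀ f₀')
    (h₁ : DecayingSolution μ₁ f₁ f₁') (hμ : μ₀ ≤ μ₁) (hp₀ : ∀ x ≥ x₀, 0 < f₀ x)
    (hp₁ : ∀ x ≥ x₀, 0 < f₁ x) (hκ : ∀ x ∈ Icc x₀ (x₀ + 1), κ ≤ f₀ x * f₁ x) :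
    κ * (μ₁ - μ₀) ≤ f₀ x₀ * f₁' x₀ - f₀' x₀ * f₁ x₀ := by
  have hW : ∀ x, HasDerivAt (fun x => f₀ x * f₁' x - f₀' x * f₁ x)
      ((μ₀ - μ₁) * (f₀ x * f₁ x)) x := fun x => by
    convert! ((h₀.deriv x).mul (h₁.deriv' x)).sub ((h₀.deriv' x).mul (h₁.deriv x)) using 1
    ring
  have hanti : AntitoneOn (fun x => f₀ x * f₁' x - f₀' x * f₁ x) (Ici x₀) := by
    refine antitoneOn_of_hasDerivWithinAt_nonpos (convex_Ici _)
      (fun x _ => (hW x).continuousAt.continuousWithinAt)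
      (fun x _ => (hW x).hasDerivWithinAt) fun x hx => ?_
    rw [interior_Ici] at hx
    exact mul_nonpos_of_nonpos_of_nonneg (by linarith)
      (mul_pos (hp₀ x (le_of_lt hx)) (hp₁ x (le_of_lt hx))).le
  have hend : 0 ≤ f₀ (x₀ + 1) * f₁' (x₀ + 1) - f₀' (x₀ + 1) * f₁ (x₀ + 1) := by
    have hlim : Tendsto (fun x => f₀ x * f₁' x - f₀' x * f₁ x) atTop (nhds 0) := by
      simpa using (tendsto_mul_zero h₀.decay h₁.decay').sub
        (tendsto_mul_zero h₀.decay' h₁.decay)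
    refine le_of_tendsto hlim ?_
    filter_upwards [eventually_ge_atTop (x₀ + 1)] with y hy
    exact hanti (by simp) (show x₀ ≤ y by linarith) hy
  have hanti' : AntitoneOn (fun x => f₀ x * f₁' x - f₀' x * f₁ x + κ * (μ₁ - μ₀) * x)
      (Icc x₀ (x₀ + 1)) := by
    have hd : ∀ x, HasDerivAt (fun x => f₀ x * f₁' x - f₀' x * f₁ x + κ * (μ₁ - μ₀) * x)
        ((μ₀ - μ₁) * (f₀ x * f₁ x) + κ * (μ₁ - μ₀)) x := fun x => by
      have hl : HasDerivAt (fun x : ℝ => κ * (μ₁ - μ₀) * x) (κ * (μ₁ - μ₀)) x := by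
        simpa using (hasDerivAt_id x).const_mul (κ * (μ₁ - μ₀))
      exact (hW x).add hl
    refine antitoneOn_of_hasDerivWithinAt_nonpos (convex_Icc _ _)
      (fun x _ => (hd x).continuousAt.continuousWithinAt)
      (fun x _ => (hd x).hasDerivWithinAt) fun x hx => ?_
    nlinarith [hκ x (interior_subset hx)]
  have := hanti' (left_mem_Icc.2 (by linarith)) (right_mem_Icc.2 (by linarith))
    (by linarith : x₀ ≤ x₀ + 1)
  simp only at this
  linarith

end DecayingSolution

namespace DecayingFamily

variable {N : ℝ} {ψ ψ' : ℝ → ℝ → ℝ}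

lemma contDiffAt (h : DecayingFamily N ψ ψ') {q : ℝ × ℝ} (hq : q.1 < N) :
    ContDiffAt ℝ (⊤ : ℕ∞) (fun q : ℝ × ℝ => ψ q.1 q.2) q :=
  h.smooth.contDiffAt ((isOpen_Iio.prod isOpen_univ).mem_nhds ⟨hq, mem_univ _⟩)

lemma contDiffAt' (h : DecayingFamily N ψ ψ') {q : ℝ × ℝ} (hq : q.1 < N) :
    ContDiffAt ℝ (⊤ : ℕ∞) (fun q : ℝ × ℝ => ψ' q.1 q.2) q :=
  h.smooth'.contDiffAt ((isOpen_Iio.prod isOpen_univ).mem_nhds ⟨hq, mem_univ _⟩)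

lemma continuousAt (h : DecayingFamily N ψ ψ') {μ : ℝ} (hμ : μ < N) (x : ℝ) :
    ContinuousAt (fun ν => ψ ν x) μ :=
  ContinuousAt.comp (f := fun ν : ℝ => (ν, x)) (g := fun q : ℝ × ℝ => ψ q.1 q.2)
    (h.contDiffAt (q := (μ, x)) hμ).continuousAt (by fun_prop)

lemma continuousAt' (h : DecayingFamily N ψ ψ') {μ : ℝ} (hμ : μ < N) (x : ℝ) :
    ContinuousAt (fun ν => ψ' ν x) μ :=
  ContinuousAt.comp (f := fun ν : ℝ => (ν, x)) (g := fun q : ℝ × ℝ => ψ' q.1 q.2)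
    (h.contDiffAt' (q := (μ, x)) hμ).continuousAt (by fun_prop)

/-- Positivity on a half-line is an open condition on the parameter and the endpoint. -/
lemma eventually_pos (h : DecayingFamily N ψ ψ') {μ₀ x₀ : ℝ} (hμ₀ : μ₀ < N)
    (hpos : ∀ x ≥ x₀, 0 < ψ μ₀ x) :
    ∀ᶠ q : ℝ × ℝ in nhds (μ₀, x₀), ∀ x ≥ q.2, 0 < ψ q.1 x := by
  obtain ⟨x₁, hx₁, hμx₁⟩ := DecayingSolution.exists_le_sq (μ₀ + 1)
  obtain ⟨a, ha, hapos⟩ : ∃ a < x₀, ∀ x ≥ a, 0 < ψ μ₀ x := by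
    have hev : ∀ᶠ x in nhds x₀, 0 < ψ μ₀ x :=
      (h.sol μ₀ hμ₀).continuous.continuousAt.eventually_const_lt (hpos x₀ le_rfl)
    obtain ⟨δ, hδ, hball⟩ := Metric.eventually_nhds_iff.1 hev
    refine ⟨x₀ - δ / 2, by linarith, fun x hx => ?_⟩
    rcases le_total x₀ x with hle | hle
    · exact hpos x hle
    · refine hball ?_
      rw [Real.dist_eq, abs_lt]
      constructor <;> linarith
  have hK : ∀ᶠ μ in nhds μ₀, ∀ x ∈ Icc a x₁, 0 < ψ μ x := by
    refine isCompact_Icc.eventually_forall_of_forall_eventually fun y hy => ?_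
    exact (h.contDiffAt (q := (μ₀, y)) hμ₀).continuousAt.eventually_const_lt (hapos y hy.1)
  have hμ : ∀ᶠ μ in nhds μ₀, μ < N ∧ μ < μ₀ + 1 :=
    (eventually_lt_nhds hμ₀).and (eventually_lt_nhds (by linarith))
  rw [nhds_prod_eq]
  filter_upwards [(hK.and hμ).prod_mk (eventually_gt_nhds ha)] with q ⟨⟨hqK, hqN, hq1⟩, hqa⟩ x hx
  rcases le_total x x₁ with hle | hle
  · exact hqK x ⟨hqa.le.trans hx, hle⟩
  · exact (h.sol q.1 hqN).pos_of_le_sq hx₁ (by linarith) x hle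

lemma pos_of_lt_mu1 (h : DecayingFamily N ψ ψ') {γ ξ μ : ℝ} (hμN : μ < N) (hμ : μ < mu1 γ ξ) :
    (∀ x ≥ -ξ, 0 < ψ μ x) ∧ ψ' μ (-ξ) < γ * ψ μ (-ξ) := by
  have hpos : ∀ x ≥ -ξ, 0 < ψ μ x := (h.sol μ hμN).pos_of_ne_zero fun x hx hx0 =>
    hμ.not_ge ((h.sol μ hμN).mu1_le_of_eq_zero γ hx hx0)
  refine ⟨hpos, ?_⟩
  by_contra hcon
  exact hμ.not_ge ((h.sol μ hμN).mu1_le_of_nonneg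
    (mul_nonneg (hpos _ le_rfl).le (by linarith)))

lemma mu1_pos_and_eq (h : DecayingFamily N ψ ψ') {γ ξ : ℝ} (hN : mu1 γ ξ < N) :
    (∀ x ≥ -ξ, 0 < ψ (mu1 γ ξ) x) ∧ ψ' (mu1 γ ξ) (-ξ) - γ * ψ (mu1 γ ξ) (-ξ) = 0 := by
  set μ₀ := mu1 γ ξ with hμ₀
  have hlt : ∀ᶠ μ in nhdsWithin μ₀ (Iio μ₀), (∀ x ≥ -ξ, 0 < ψ μ x) ∧
      ψ' μ (-ξ) < γ * ψ μ (-ξ) := by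
    filter_upwards [self_mem_nhdsWithin] with μ hμ
    exact h.pos_of_lt_mu1 (lt_trans hμ hN) hμ
  have hle : ψ' μ₀ (-ξ) ≤ γ * ψ μ₀ (-ξ) :=
    le_of_tendsto_of_tendsto ((h.continuousAt' hN (-ξ)).tendsto.mono_left nhdsWithin_le_nhds)
      (((h.continuousAt hN (-ξ)).tendsto.const_mul γ).mono_left nhdsWithin_le_nhds)
      (hlt.mono fun μ hμ => hμ.2.le)
  have hpos : ∀ x ≥ -ξ, 0 < ψ μ₀ x := (h.sol μ₀ hN).pos_of_nonneg (fun x hx =>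
    ge_of_tendsto ((h.continuousAt hN x).tendsto.mono_left nhdsWithin_le_nhds)
      (hlt.mono fun μ hμ => (hμ.1 x hx).le)) hle
  refine ⟨hpos, ?_⟩
  by_contra hne
  have hneg : ψ' μ₀ (-ξ) - γ * ψ μ₀ (-ξ) < 0 := lt_of_le_of_ne (by linarith) hne
  have hev : ∀ᶠ μ in nhds μ₀, (∀ x ≥ -ξ, 0 < ψ μ x) ∧ ψ' μ (-ξ) - γ * ψ μ (-ξ) < 0 ∧ μ < N :=
    (((show ContinuousAt (fun μ : ℝ => (μ, -ξ)) μ₀ by fun_prop).tendsto).eventually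
      (h.eventually_pos hN hpos)).and
      ((((h.continuousAt' hN (-ξ)).sub ((h.continuousAt hN (-ξ)).const_mul γ)).eventually_lt_const
        hneg).and (eventually_lt_nhds hN))
  obtain ⟨μ, ⟨hμpos, hμneg, hμN⟩, hμ⟩ :=
    ((hev.filter_mono nhdsWithin_le_nhds).and (self_mem_nhdsWithin (s := Ioi μ₀))).exists
  exact absurd ((h.sol μ hμN).le_mu1 hμpos (by linarith)) (not_le.2 hμ)

/-- The boundary condition is transversal in the spectral parameter at the ground state energy. -/
lemma boundary_deriv_pos (h : DecayingFamily N ψ ψ') {γ ξ D : ℝ} (hN : mu1 γ ξ < N)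
    (hD : HasDerivAt (fun μ => ψ' μ (-ξ) - γ * ψ μ (-ξ)) D (mu1 γ ξ)) : 0 < D := by
  obtain ⟨hpos, heq⟩ := h.mu1_pos_and_eq hN
  set μ₀ := mu1 γ ξ
  obtain ⟨c, hc, hmin⟩ := (isCompact_Icc (a := -ξ) (b := -ξ + 1)).exists_isMinOn
    (nonempty_Icc.2 (by linarith)) (h.sol μ₀ hN).continuous.continuousOn
  have hc0 : 0 < ψ μ₀ c := hpos c hc.1
  have hK : ∀ᶠ μ in nhds μ₀, ∀ x ∈ Icc (-ξ) (-ξ + 1), ψ μ₀ c / 2 < ψ μ x := by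
    refine isCompact_Icc.eventually_forall_of_forall_eventually fun y hy => ?_
    refine (h.contDiffAt (q := (μ₀, y)) hN).continuousAt.eventually_const_lt ?_
    have : ψ μ₀ c ≤ ψ μ₀ y := hmin hy
    simp only
    linarith
  have hp := hpos (-ξ) le_rfl
  have hall : ∀ᶠ μ in nhds μ₀, ∀ x ≥ -ξ, 0 < ψ μ x :=
    ((show ContinuousAt (fun μ : ℝ => (μ, -ξ)) μ₀ by fun_prop).tendsto).eventually
      (h.eventually_pos hN hpos)
  refine lt_of_lt_of_le (show 0 < ψ μ₀ c * (ψ μ₀ c / 2) / ψ μ₀ (-ξ) by positivity)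
    (ge_of_tendsto ((hasDerivWithinAt_iff_tendsto_slope' (s := Ioi μ₀) (by simp)).1
        hD.hasDerivWithinAt) ?_)
  filter_upwards [self_mem_nhdsWithin, nhdsWithin_le_nhds hK, nhdsWithin_le_nhds hall,
    nhdsWithin_le_nhds (eventually_lt_nhds hN)] with μ hμ hμK hμpos hμN
  have hμ' : μ₀ < μ := hμ
  have hW := (h.sol μ₀ hN).le_wronskian (h.sol μ hμN) hμ'.le hpos hμpos
    (κ := ψ μ₀ c * (ψ μ₀ c / 2)) fun x hx =>
      mul_le_mul (hmin hx) (hμK x hx).le (by positivity) (hpos x hx.1).le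
  rw [slope_def_field, heq, sub_zero, div_le_div_iff₀ hp (sub_pos.2 hμ')]
  rw [sub_eq_zero.1 heq] at hW
  linarith

end DecayingFamily

lemma contDiffAt_mu1 (γ ξ : ℝ) :
    ContDiffAt ℝ (⊤ : ℕ∞) (fun p : ℝ × ℝ => mu1 p.1 p.2) (γ, ξ) := by
  obtain ⟨N, hN, ψ, ψ', h⟩ := exists_decayingFamily (mu1 γ ξ)
  obtain ⟨hpos, heq⟩ := h.mu1_pos_and_eq hN
  let H : (ℝ × ℝ) × ℝ → ℝ := fun v => ψ' v.2 (-v.1.2) - v.1.1 * ψ v.2 (-v.1.2)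
  let u : (ℝ × ℝ) × ℝ := ((γ, ξ), mu1 γ ξ)
  have hH : ContDiffAt ℝ (⊤ : ℕ∞) H u := by
    have hin : ContDiffAt ℝ (⊤ : ℕ∞) (fun v : (ℝ × ℝ) × ℝ => (v.2, -v.1.2)) u := by fun_prop
    have h1 : ContDiffAt ℝ (⊤ : ℕ∞) (fun v : (ℝ × ℝ) × ℝ => v.1.1) u := by fun_prop
    exact ((h.contDiffAt' (q := (mu1 γ ξ, -ξ)) hN).comp u hin).sub
      (h1.mul ((h.contDiffAt (q := (mu1 γ ξ, -ξ)) hN).comp u hin))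
  have hn : ((⊤ : ℕ∞) : WithTop ℕ∞) ≠ 0 := by simp
  have hD : HasDerivAt (fun μ => ψ' μ (-ξ) - γ * ψ μ (-ξ))
      (fderiv ℝ H u (0, 1)) (mu1 γ ξ) :=
    ((hH.differentiableAt hn).hasFDerivAt (x := u)).comp_hasDerivAt (f := fun μ => ((γ, ξ), μ))
      (mu1 γ ξ) ((hasDerivAt_const _ _).prodMk (hasDerivAt_id _))
  have hDpos := h.boundary_deriv_pos hN hD
  have hinv : (fderiv ℝ H u ∘L .inr ℝ (ℝ × ℝ) ℝ).IsInvertible := by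
    refine ⟨ContinuousLinearEquiv.unitsEquivAut ℝ (Units.mk0 _ hDpos.ne'), ?_⟩
    ext
    simp
  have hφ := hH.contDiffAt_implicitFunction hn hinv
  have hφ0 := hH.implicitFunction_apply_self hn hinv
  have hφev := hH.eventually_apply_implicitFunction hn hinv
  set φ := hH.implicitFunction hn hinv
  refine hφ.congr_of_eventuallyEq ?_
  have hcont : Tendsto (fun p : ℝ × ℝ => (φ p, -p.2)) (nhds (γ, ξ)) (nhds (mu1 γ ξ, -ξ)) := by
    have : Tendsto φ (nhds (γ, ξ)) (nhds (mu1 γ ξ)) := by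
      simpa [hφ0, u] using hφ.continuousAt.tendsto
    exact this.prodMk_nhds (continuous_snd.neg.tendsto (γ, ξ))
  have hltN : ∀ᶠ p : ℝ × ℝ in nhds (γ, ξ), φ p < N :=
    (hcont.eventually ((continuous_fst.tendsto (mu1 γ ξ, -ξ)).eventually_lt_const hN))
  filter_upwards [hφev, hcont.eventually (h.eventually_pos hN hpos), hltN] with p hp hppos hpN
  have hz : ψ' (φ p) (-p.2) - p.1 * ψ (φ p) (-p.2) = 0 := hp.trans heq
  refine le_antisymm ((h.sol _ hpN).mu1_le_of_nonneg ?_)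
    ((h.sol _ hpN).le_mu1 hppos (by linarith))
  rw [hz, mul_zero]

/-- The function `(γ,ξ) ↦ μ⁽¹⁾(γ,ξ)` is of class `C^∞` on `ℝ²`. -/
theorem mu1_smooth : ContDiff ℝ (⊤ : ℕ∞) (fun p : ℝ × ℝ => mu1 p.1 p.2) := by
  exact contDiff_iff_contDiffAt.2 fun p => contDiffAt_mu1 p.1 p.2
end

section
/- The function γ ↦ Θ(γ) is of class C^∞ on ℝ. -/
open MeasureTheory Set Filter

/-- The weight `s ^ (ν - 1) * exp (-s² / 4 - x s)` in the integral representation of the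
parabolic cylinder functions. -/
noncomputable def pcWeight (ν x s : ℝ) : ℝ := s ^ (ν - 1) * Real.exp (-s ^ 2 / 4 - x * s)

/-- The moment `∫₀^∞ h(s) s ^ (ν - 1) exp (-s² / 4 - x s) ds` as a function of `(ν, x)`. -/
noncomputable def pcMoment (h : ℝ → ℝ) (p : ℝ × ℝ) : ℝ :=
  ∫ s in Ioi (0:ℝ), h s * pcWeight p.1 p.2 s

/-- Measurable functions which are integrable against all the weights `pcWeight ν x`, `0 < ν`. -/
def PcIntegrable (h : ℝ → ℝ) : Prop :=
  Measurable h ∧ ∀ ν : ℝ, 0 < ν → ∀ x : ℝ, IntegrableOn (fun s => h s * pcWeight ν x s) (Ioi 0)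

lemma pcWeight_pos (ν x : ℝ) {s : ℝ} (hs : 0 < s) : 0 < pcWeight ν x s :=
  mul_pos (Real.rpow_pos_of_pos hs _) (Real.exp_pos _)

lemma measurable_pcWeight (ν x : ℝ) : Measurable (pcWeight ν x) := by
  unfold pcWeight
  fun_prop

lemma pcWeight_add (ν a x : ℝ) {s : ℝ} (hs : 0 < s) :
    pcWeight (ν + a) x s = s ^ a * pcWeight ν x s := by
  unfold pcWeight
  rw [show ν + a - 1 = a + (ν - 1) by ring, Real.rpow_add hs, mul_assoc]

lemma pcWeight_add_one (ν x : ℝ) {s : ℝ} (hs : 0 < s) :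
    pcWeight (ν + 1) x s = s * pcWeight ν x s := by
  rw [pcWeight_add ν 1 x hs, Real.rpow_one]

lemma pcWeight_eq_exp (ν x : ℝ) {s : ℝ} (hs : 0 < s) :
    pcWeight ν x s = Real.exp (Real.log s * (ν - 1) + (-s ^ 2 / 4 - x * s)) := by
  rw [pcWeight, Real.rpow_def_of_pos hs, Real.exp_add]

lemma pcIntegrable_one : PcIntegrable (fun _ => 1) := by
  refine ⟨measurable_const, fun ν hν x => ?_⟩
  have hb := (integrableOn_rpow_mul_exp_neg_mul_sq (b := 1 / 8) (by norm_num)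
    (s := ν - 1) (by linarith)).const_mul (Real.exp (2 * x ^ 2))
  refine Integrable.mono' hb
    (measurable_const.mul (measurable_pcWeight ν x)).aestronglyMeasurable ?_
  filter_upwards [ae_restrict_mem measurableSet_Ioi] with s hs
  have hs : 0 < s := hs
  rw [one_mul, Real.norm_of_nonneg (pcWeight_pos ν x hs).le, pcWeight, mul_left_comm,
    ← Real.exp_add]
  gcongr
  nlinarith [sq_nonneg (s + 4 * x)]

lemma PcIntegrable.neg {h : ℝ → ℝ} (hh : PcIntegrable h) : PcIntegrable (fun s => -h s) := by
  refine ⟨hh.1.neg, fun ν hν x => ?_⟩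
  simpa [neg_mul] using (hh.2 ν hν x).neg

lemma PcIntegrable.id_mul {h : ℝ → ℝ} (hh : PcIntegrable h) : PcIntegrable (fun s => s * h s) := by
  refine ⟨measurable_id.mul hh.1, fun ν hν x => ?_⟩
  refine (hh.2 (ν + 1) (by linarith) x).congr_fun (fun s hs => ?_) measurableSet_Ioi
  simp only [pcWeight_add_one ν x hs]
  ring

lemma abs_log_le_rpow {s ε : ℝ} (hs : 0 < s) (hε : 0 < ε) :
    |Real.log s| ≤ ε⁻¹ * (s ^ ε + s ^ (-ε)) := by
  have h1 := Real.log_le_rpow_div hs.le hε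
  have h2 := Real.log_le_rpow_div (inv_pos.2 hs).le hε
  rw [Real.log_inv, Real.inv_rpow hs.le, ← Real.rpow_neg hs.le] at h2
  have h3 : 0 ≤ s ^ ε / ε := by positivity
  have h4 : 0 ≤ s ^ (-ε) / ε := by positivity
  rw [abs_le]
  constructor <;> rw [mul_add, inv_mul_eq_div, inv_mul_eq_div] <;> linarith

lemma PcIntegrable.log_mul {h : ℝ → ℝ} (hh : PcIntegrable h) :
    PcIntegrable (fun s => Real.log s * h s) := by
  refine ⟨Real.measurable_log.mul hh.1, fun ν hν x => ?_⟩
  have hb := ((hh.2 (ν + ν / 2) (by linarith) x).norm.add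
    (hh.2 (ν + -(ν / 2)) (by linarith) x).norm).const_mul (ν / 2)⁻¹
  refine Integrable.mono' hb
    ((Real.measurable_log.mul hh.1).mul (measurable_pcWeight ν x)).aestronglyMeasurable ?_
  filter_upwards [ae_restrict_mem measurableSet_Ioi] with s hs
  have hs : 0 < s := hs
  have hw := pcWeight_pos ν x hs
  have hl := abs_log_le_rpow hs (half_pos hν)
  have h1 : (0:ℝ) < s ^ (ν / 2) := by positivity
  have h2 : (0:ℝ) < s ^ (-(ν / 2)) := by positivity
  simp only [Pi.add_apply, norm_mul, Real.norm_eq_abs, pcWeight_add ν _ x hs, abs_mul,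
    abs_of_pos hw, abs_of_pos h1, abs_of_pos h2]
  calc |Real.log s| * |h s| * pcWeight ν x s
      = |Real.log s| * (|h s| * pcWeight ν x s) := by ring
    _ ≤ ((ν / 2)⁻¹ * (s ^ (ν / 2) + s ^ (-(ν / 2)))) * (|h s| * pcWeight ν x s) := by gcongr
    _ = _ := by ring

/-- Domination of the weights for parameters in a ball. -/
lemma pcWeight_le_of_mem_ball {ν x r : ℝ} {p : ℝ × ℝ} (hp : p ∈ Metric.ball (ν, x) r) {s : ℝ}
    (hs : 0 < s) :
    pcWeight p.1 p.2 s ≤ pcWeight (ν - r) (x - r) s + pcWeight (ν + r) (x - r) s := by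
  obtain ⟨h1, h2⟩ : |p.1 - ν| < r ∧ |p.2 - x| < r := by
    simpa [Prod.dist_eq, Real.dist_eq] using hp
  rw [abs_lt] at h1 h2
  have he : Real.exp (-s ^ 2 / 4 - p.2 * s) ≤ Real.exp (-s ^ 2 / 4 - (x - r) * s) := by
    apply Real.exp_le_exp.2
    nlinarith
  have hr : s ^ (p.1 - 1) ≤ s ^ (ν - r - 1) + s ^ (ν + r - 1) := by
    have e1 : 0 < s ^ (ν - r - 1) := by positivity
    have e2 : 0 < s ^ (ν + r - 1) := by positivity
    rcases le_total s 1 with h | h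
    · have := Real.rpow_le_rpow_of_exponent_ge hs h (show ν - r - 1 ≤ p.1 - 1 by linarith)
      linarith
    · have := Real.rpow_le_rpow_of_exponent_le h (show p.1 - 1 ≤ ν + r - 1 by linarith)
      linarith
  unfold pcWeight
  rw [← add_mul]
  gcongr

lemma hasFDerivAt_mul_pcWeight (c : ℝ) {s : ℝ} (hs : 0 < s) (p : ℝ × ℝ) :
    HasFDerivAt (fun p : ℝ × ℝ => c * pcWeight p.1 p.2 s)
      ((Real.log s * c * pcWeight p.1 p.2 s) • ContinuousLinearMap.fst ℝ ℝ ℝ +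
        (-(s * c) * pcWeight p.1 p.2 s) • ContinuousLinearMap.snd ℝ ℝ ℝ) p := by
  have h1 : HasFDerivAt (fun p : ℝ × ℝ => Real.log s * (p.1 - 1) + (-s ^ 2 / 4 - p.2 * s))
      (Real.log s • ContinuousLinearMap.fst ℝ ℝ ℝ + -(s • ContinuousLinearMap.snd ℝ ℝ ℝ)) p :=
    ((hasFDerivAt_fst.sub_const 1).const_mul _).add ((hasFDerivAt_snd.mul_const s).const_sub _)
  have h2 := (h1.exp).const_mul c
  simp only [← pcWeight_eq_exp _ _ hs] at h2
  refine h2.congr_fderiv ?_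
  ext <;> simp <;> ring

lemma hasFDerivAt_pcMoment {h : ℝ → ℝ} (hh : PcIntegrable h) {p : ℝ × ℝ} (hp : 0 < p.1) :
    HasFDerivAt (pcMoment h)
      (pcMoment (fun s => Real.log s * h s) p • ContinuousLinearMap.fst ℝ ℝ ℝ +
        pcMoment (fun s => -(s * h s)) p • ContinuousLinearMap.snd ℝ ℝ ℝ) p := by
  have hl := hh.log_mul
  have hi := hh.id_mul.neg
  have key := hasFDerivAt_integral_of_dominated_of_fderiv_le (μ := volume.restrict (Ioi (0:ℝ)))
    (𝕜 := ℝ) (s := Metric.ball p (p.1 / 2)) (x₀ := p)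
    (F := fun (q : ℝ × ℝ) s => h s * pcWeight q.1 q.2 s)
    (F' := fun (q : ℝ × ℝ) s =>
      (Real.log s * h s * pcWeight q.1 q.2 s) • ContinuousLinearMap.fst ℝ ℝ ℝ +
        (-(s * h s) * pcWeight q.1 q.2 s) • ContinuousLinearMap.snd ℝ ℝ ℝ)
    (bound := fun s => ‖Real.log s * h s * pcWeight (p.1 - p.1 / 2) (p.2 - p.1 / 2) s‖ +
      ‖Real.log s * h s * pcWeight (p.1 + p.1 / 2) (p.2 - p.1 / 2) s‖ +
      (‖-(s * h s) * pcWeight (p.1 - p.1 / 2) (p.2 - p.1 / 2) s‖ +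
      ‖-(s * h s) * pcWeight (p.1 + p.1 / 2) (p.2 - p.1 / 2) s‖))
    (Metric.ball_mem_nhds _ (half_pos hp))
    (Eventually.of_forall fun q => (hh.1.mul (measurable_pcWeight _ _)).aestronglyMeasurable)
    (hh.2 _ hp _) ?_ ?_ ?_ ?_
  · rw [integral_add ((hl.2 _ hp _).smul_const _) ((hi.2 _ hp _).smul_const _),
      integral_smul_const, integral_smul_const] at key
    exact key
  · exact ((hl.2 _ hp _).smul_const _).aestronglyMeasurable.add
      ((hi.2 _ hp _).smul_const _).aestronglyMeasurable
  · filter_upwards [ae_restrict_mem measurableSet_Ioi] with s hs q hq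
    have hs : 0 < s := hs
    have hw := pcWeight_le_of_mem_ball hq hs
    have hbound : ∀ c : ℝ, ‖c * pcWeight q.1 q.2 s‖ ≤
        ‖c * pcWeight (p.1 - p.1 / 2) (p.2 - p.1 / 2) s‖ +
          ‖c * pcWeight (p.1 + p.1 / 2) (p.2 - p.1 / 2) s‖ := by
      intro c
      rw [norm_mul, norm_mul, norm_mul, ← mul_add, Real.norm_of_nonneg (pcWeight_pos _ _ hs).le,
        Real.norm_of_nonneg (pcWeight_pos _ _ hs).le, Real.norm_of_nonneg (pcWeight_pos _ _ hs).le]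
      gcongr
    refine (norm_add_le _ _).trans (add_le_add ?_ ?_)
    · rw [norm_smul]
      exact (mul_le_of_le_one_right (norm_nonneg _) (ContinuousLinearMap.norm_fst_le ..)).trans
        (hbound _)
    · rw [norm_smul]
      exact (mul_le_of_le_one_right (norm_nonneg _) (ContinuousLinearMap.norm_snd_le ..)).trans
        (hbound _)
  · have e1 : 0 < p.1 - p.1 / 2 := by linarith
    have e2 : 0 < p.1 + p.1 / 2 := by linarith
    exact ((hl.2 _ e1 _).norm.add (hl.2 _ e2 _).norm).add
      ((hi.2 _ e1 _).norm.add (hi.2 _ e2 _).norm)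
  · filter_upwards [ae_restrict_mem measurableSet_Ioi] with s hs q hq
    exact hasFDerivAt_mul_pcWeight (h s) hs q

lemma contDiffOn_pcMoment (n : ℕ) : ∀ {h : ℝ → ℝ}, PcIntegrable h →
    ContDiffOn ℝ n (pcMoment h) {p : ℝ × ℝ | 0 < p.1} := by
  have ho : IsOpen {p : ℝ × ℝ | 0 < p.1} := isOpen_lt continuous_const continuous_fst
  induction n with
  | zero =>
    intro h hh
    exact contDiffOn_zero.2 fun p hp => (hasFDerivAt_pcMoment hh hp).continuousAt.continuousWithinAt
  | succ n ih =>
    intro h hh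
    rw [Nat.cast_succ, contDiffOn_succ_iff_fderiv_of_isOpen ho]
    refine ⟨fun p hp => (hasFDerivAt_pcMoment hh hp).differentiableAt.differentiableWithinAt,
      by simp, ?_⟩
    refine ContDiffOn.congr ?_ fun p hp => (hasFDerivAt_pcMoment hh hp).fderiv
    exact ((ih hh.log_mul).smul contDiffOn_const).add ((ih hh.id_mul.neg).smul contDiffOn_const)

/-- The function `F(ν, x) = ∫₀^∞ s ^ (ν - 1) exp (-s² / 4 - x s) ds`. -/
noncomputable def pcF (ν x : ℝ) : ℝ := pcMoment (fun _ => 1) (ν, x)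

/-- The derivative of `pcF` with respect to the first variable. -/
noncomputable def pcFLog (ν x : ℝ) : ℝ := pcMoment (fun s => Real.log s) (ν, x)

lemma integrableOn_pcWeight {ν : ℝ} (hν : 0 < ν) (x : ℝ) :
    IntegrableOn (pcWeight ν x) (Ioi 0) := by
  simpa using pcIntegrable_one.2 ν hν x

lemma integrableOn_log_mul_pcWeight {ν : ℝ} (hν : 0 < ν) (x : ℝ) :
    IntegrableOn (fun s => Real.log s * pcWeight ν x s) (Ioi 0) := by
  simpa using pcIntegrable_one.log_mul.2 ν hν x

lemma pcF_eq (ν x : ℝ) : pcF ν x = ∫ s in Ioi (0:ℝ), pcWeight ν x s := by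
  simp [pcF, pcMoment]

lemma pcFLog_eq (ν x : ℝ) : pcFLog ν x = ∫ s in Ioi (0:ℝ), Real.log s * pcWeight ν x s := rfl

/-- An integral against a weight is positive if the integrand is nonnegative and vanishes at most
at one point. -/
lemma setIntegral_Ioi_pos {f : ℝ → ℝ} (hf : IntegrableOn f (Ioi 0)) (m : ℝ)
    (hnn : ∀ s, 0 < s → 0 ≤ f s) (hpos : ∀ s, 0 < s → s ≠ m → 0 < f s) :
    0 < ∫ s in Ioi (0:ℝ), f s := by
  rw [setIntegral_pos_iff_support_of_nonneg_ae _ hf]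
  · have hsub : Ioi 0 \ {m} ⊆ Function.support f ∩ Ioi 0 :=
      fun s hs => ⟨(hpos s hs.1 hs.2).ne', hs.1⟩
    refine lt_of_lt_of_le ?_ (measure_mono hsub)
    rw [measure_sdiff_null (by simp)]
    simp
  · filter_upwards [ae_restrict_mem measurableSet_Ioi] with s hs using hnn s hs

lemma pcF_pos {ν : ℝ} (hν : 0 < ν) (x : ℝ) : 0 < pcF ν x := by
  rw [pcF_eq]
  exact setIntegral_Ioi_pos (integrableOn_pcWeight hν x) 0 (fun s hs => (pcWeight_pos ν x hs).le)
    fun s hs _ => pcWeight_pos ν x hs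

lemma integral_id_mul_pcWeight (ν x : ℝ) :
    ∫ s in Ioi (0:ℝ), s * pcWeight ν x s = pcF (ν + 1) x := by
  rw [pcF_eq]
  exact setIntegral_congr_fun measurableSet_Ioi fun s hs => (pcWeight_add_one ν x hs).symm

lemma hasFDerivAt_pcF {p : ℝ × ℝ} (hp : 0 < p.1) :
    HasFDerivAt (fun p : ℝ × ℝ => pcF p.1 p.2)
      (pcFLog p.1 p.2 • ContinuousLinearMap.fst ℝ ℝ ℝ +
        (-pcF (p.1 + 1) p.2) • ContinuousLinearMap.snd ℝ ℝ ℝ) p := by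
  have h := hasFDerivAt_pcMoment pcIntegrable_one hp
  have h1 : pcMoment (fun s => -(s * 1)) p = -pcF (p.1 + 1) p.2 := by
    rw [← integral_id_mul_pcWeight, ← integral_neg]
    simp [pcMoment]
  rw [h1] at h
  simp only [mul_one] at h
  exact h

lemma contDiffOn_pcF (n : ℕ) :
    ContDiffOn ℝ n (fun p : ℝ × ℝ => pcF p.1 p.2) {p : ℝ × ℝ | 0 < p.1} :=
  contDiffOn_pcMoment n pcIntegrable_one

lemma contDiffAt_pcF {p : ℝ × ℝ} (hp : 0 < p.1) :
    ContDiffAt ℝ (⊤ : ℕ∞) (fun p : ℝ × ℝ => pcF p.1 p.2) p :=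
  (contDiffOn_infty.2 contDiffOn_pcF).contDiffAt
    ((isOpen_lt continuous_const continuous_fst).mem_nhds hp)

lemma hasDerivAt_pcF {ν : ℝ} (hν : 0 < ν) (x : ℝ) :
    HasDerivAt (pcF ν) (-pcF (ν + 1) x) x := by
  have h := (hasFDerivAt_pcF (p := (ν, x)) hν).comp_hasDerivAt x
    ((hasDerivAt_const x ν).prodMk (hasDerivAt_id x))
  simpa using! h

lemma pcF_antitone {ν : ℝ} (hν : 0 < ν) : Antitone (pcF ν) :=
  antitone_of_hasDerivAt_nonpos (hasDerivAt_pcF hν)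
    fun x => neg_nonpos.2 (pcF_pos (by linarith) x).le

lemma hasDerivAt_pcWeight_add_one (ν x : ℝ) {s : ℝ} (hs : 0 < s) :
    HasDerivAt (pcWeight (ν + 1) x)
      (ν * pcWeight ν x s - 2⁻¹ * pcWeight (ν + 2) x s - x * pcWeight (ν + 1) x s) s := by
  have h1 : HasDerivAt (fun s : ℝ => s ^ (ν + 1 - 1)) ((ν + 1 - 1) * s ^ (ν + 1 - 1 - 1)) s :=
    Real.hasDerivAt_rpow_const (Or.inl hs.ne')
  have h2 : HasDerivAt (fun s : ℝ => -s ^ 2 / 4 - x * s) (-(2 * s) / 4 - x) s := by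
    have := ((hasDerivAt_pow 2 s).neg.div_const 4).sub ((hasDerivAt_id s).const_mul x)
    simpa using! this
  refine (h1.mul h2.exp).congr_deriv ?_
  rw [show ν + 2 = ν + 1 + 1 by ring, pcWeight_add_one _ _ hs, pcWeight_add_one _ _ hs]
  have h3 : s ^ (ν + 1 - 1) = s * s ^ (ν - 1) := by
    rw [show ν + 1 - 1 = 1 + (ν - 1) by ring, Real.rpow_add hs, Real.rpow_one]
  rw [h3]
  unfold pcWeight
  rw [show ν + 1 - 1 - 1 = ν - 1 by ring]
  ring

/-- The three-term recursion, obtained by integrating by parts. -/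
lemma pcF_recursion {ν : ℝ} (hν : 0 ≤ ν) (x : ℝ) :
    ν * pcF ν x - 2⁻¹ * pcF (ν + 2) x - x * pcF (ν + 1) x = -(0 ^ ν) := by
  have i0 : IntegrableOn (fun s => ν * pcWeight ν x s) (Ioi 0) := by
    rcases hν.eq_or_lt with rfl | h
    · simp
    · exact (integrableOn_pcWeight h x).const_mul _
  have i1 : IntegrableOn (fun s => x * pcWeight (ν + 1) x s) (Ioi 0) :=
    (integrableOn_pcWeight (by linarith) x).const_mul _
  have i2 : IntegrableOn (fun s => 2⁻¹ * pcWeight (ν + 2) x s) (Ioi 0) :=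
    (integrableOn_pcWeight (by linarith) x).const_mul _
  have hd : ∀ s ∈ Ioi (0:ℝ), HasDerivAt (pcWeight (ν + 1) x)
      (ν * pcWeight ν x s - 2⁻¹ * pcWeight (ν + 2) x s - x * pcWeight (ν + 1) x s) s :=
    fun s hs => hasDerivAt_pcWeight_add_one ν x hs
  have hc : ContinuousWithinAt (pcWeight (ν + 1) x) (Ici 0) 0 := by
    have : Continuous (pcWeight (ν + 1) x) := by
      unfold pcWeight
      exact (Real.continuous_rpow_const (by linarith)).mul (by fun_prop)
    exact this.continuousWithinAt
  have h := integral_Ioi_of_hasDerivAt_of_tendsto hc hd ((i0.sub i2).sub i1)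
    (tendsto_zero_of_hasDerivAt_of_integrableOn_Ioi hd ((i0.sub i2).sub i1)
      (integrableOn_pcWeight (by linarith) x))
  have i02 : IntegrableOn (fun s => ν * pcWeight ν x s - 2⁻¹ * pcWeight (ν + 2) x s) (Ioi 0) :=
    i0.sub i2
  rw [integral_sub i02 i1, integral_sub i0 i2, integral_const_mul, integral_const_mul,
    integral_const_mul, ← pcF_eq, ← pcF_eq, ← pcF_eq] at h
  rw [h]
  simp [pcWeight]

lemma mul_pcF {ν : ℝ} (hν : 0 < ν) (x : ℝ) :
    ν * pcF ν x = 2⁻¹ * pcF (ν + 2) x + x * pcF (ν + 1) x := by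
  have := pcF_recursion hν.le x
  rw [Real.zero_rpow hν.ne'] at this
  linarith

/-- Log-convexity of `pcF ν`. -/
lemma sq_pcF_add_one_le {ν : ℝ} (hν : 0 < ν) (x : ℝ) :
    pcF (ν + 1) x ^ 2 ≤ pcF ν x * pcF (ν + 2) x := by
  have hF := pcF_pos hν x
  set m := pcF (ν + 1) x / pcF ν x with hm
  have i0 := integrableOn_pcWeight hν x
  have i1 := integrableOn_pcWeight (show 0 < ν + 1 by linarith) x
  have i2 := integrableOn_pcWeight (show 0 < ν + 2 by linarith) x
  have h0 : 0 ≤ ∫ s in Ioi (0:ℝ),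
      (pcWeight (ν + 2) x s - 2 * m * pcWeight (ν + 1) x s + m ^ 2 * pcWeight ν x s) := by
    refine setIntegral_nonneg measurableSet_Ioi fun s hs => ?_
    rw [show ν + 2 = ν + 1 + 1 by ring, pcWeight_add_one _ _ hs, pcWeight_add_one _ _ hs]
    have := pcWeight_pos ν x hs
    nlinarith [mul_nonneg this.le (sq_nonneg (s - m))]
  have i21 : IntegrableOn (fun s => pcWeight (ν + 2) x s - 2 * m * pcWeight (ν + 1) x s) (Ioi 0) :=
    i2.sub (i1.const_mul _)
  rw [integral_add i21 (i0.const_mul _),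
    integral_sub i2 (i1.const_mul _), integral_const_mul, integral_const_mul,
    ← pcF_eq, ← pcF_eq, ← pcF_eq] at h0
  have hm' : m * pcF ν x = pcF (ν + 1) x := by rw [hm]; field_simp
  rw [← hm'] at h0 ⊢
  nlinarith

/-- Strict monotonicity of the mean `pcF (ν + 1) x / pcF ν x` in `ν`, in infinitesimal form. -/
lemma pcFLog_covariance_pos {ν : ℝ} (hν : 0 < ν) (x : ℝ) :
    0 < pcFLog (ν + 1) x * pcF ν x - pcF (ν + 1) x * pcFLog ν x := by
  have hF := pcF_pos hν x
  have hF1 := pcF_pos (show 0 < ν + 1 by linarith) x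
  set m := pcF (ν + 1) x / pcF ν x with hm
  have hmpos : 0 < m := div_pos hF1 hF
  have hm' : m * pcF ν x = pcF (ν + 1) x := by rw [hm]; field_simp
  have i0 := integrableOn_pcWeight hν x
  have i1 := integrableOn_pcWeight (show 0 < ν + 1 by linarith) x
  have l0 := integrableOn_log_mul_pcWeight hν x
  have l1 := integrableOn_log_mul_pcWeight (show 0 < ν + 1 by linarith) x
  have i10 : IntegrableOn (fun s => pcWeight (ν + 1) x s - m * pcWeight ν x s) (Ioi 0) :=
    i1.sub (i0.const_mul m)
  have l10 : IntegrableOn (fun s =>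
      Real.log s * pcWeight (ν + 1) x s - m * (Real.log s * pcWeight ν x s)) (Ioi 0) :=
    l1.sub (l0.const_mul m)
  have key : 0 < ∫ s in Ioi (0:ℝ),
      ((Real.log s * pcWeight (ν + 1) x s - m * (Real.log s * pcWeight ν x s)) -
        Real.log m * (pcWeight (ν + 1) x s - m * pcWeight ν x s)) := by
    have e : ∀ s, 0 < s →
      ((Real.log s * pcWeight (ν + 1) x s - m * (Real.log s * pcWeight ν x s)) -
        Real.log m * (pcWeight (ν + 1) x s - m * pcWeight ν x s)) =
        (s - m) * (Real.log s - Real.log m) * pcWeight ν x s := by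
      intro s hs
      rw [pcWeight_add_one _ _ hs]
      ring
    have hp : ∀ s, 0 < s → s ≠ m → 0 < (s - m) * (Real.log s - Real.log m) := by
      intro s hs hsm
      rcases lt_or_gt_of_ne hsm with h | h
      · exact mul_pos_of_neg_of_neg (by linarith) (by linarith [Real.log_lt_log hs h])
      · exact mul_pos (by linarith) (by linarith [Real.log_lt_log hmpos h])
    refine setIntegral_Ioi_pos (l10.sub (i10.const_mul _)) m
      (fun s hs => ?_) fun s hs hsm => ?_
    · rw [e s hs]
      refine mul_nonneg ?_ (pcWeight_pos ν x hs).le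
      rcases eq_or_ne s m with h | h
      · simp [h]
      · exact (hp s hs h).le
    · rw [e s hs]
      exact mul_pos (hp s hs hsm) (pcWeight_pos ν x hs)
  rw [integral_sub l10 (i10.const_mul _),
    integral_const_mul, integral_sub l1 (l0.const_mul m), integral_sub i1 (i0.const_mul m),
    integral_const_mul, integral_const_mul, ← pcF_eq, ← pcF_eq, ← pcFLog_eq, ← pcFLog_eq, hm',
    sub_self, mul_zero, sub_zero] at key
  rw [← hm']
  nlinarith

/-- The solution of `-U'' + x² U = (1 - 2ν) U` which decays at `+∞`. -/
noncomputable def pcU (ν x : ℝ) : ℝ := Real.exp (-x ^ 2 / 2) * pcF ν x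

/-- The derivative of `pcU ν`. -/
noncomputable def pcV (ν x : ℝ) : ℝ :=
  Real.exp (-x ^ 2 / 2) * (-x * pcF ν x - pcF (ν + 1) x)

/-- The logarithmic derivative of `pcU ν`. -/
noncomputable def pcG (ν x : ℝ) : ℝ := -x - pcF (ν + 1) x / pcF ν x

/-- The product of `(pcU ν)²` with the derivative of `pcG ν`. -/
noncomputable def pcW (ν x : ℝ) : ℝ := (x ^ 2 - (1 - 2 * ν)) * pcU ν x ^ 2 - pcV ν x ^ 2

lemma pcU_pos {ν : ℝ} (hν : 0 < ν) (x : ℝ) : 0 < pcU ν x :=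
  mul_pos (Real.exp_pos _) (pcF_pos hν x)

lemma pcV_eq {ν : ℝ} (hν : 0 < ν) (x : ℝ) : pcV ν x = pcG ν x * pcU ν x := by
  have := (pcF_pos hν x).ne'
  unfold pcV pcG pcU
  field_simp

lemma hasDerivAt_exp_neg_sq_div_two (x : ℝ) :
    HasDerivAt (fun x : ℝ => Real.exp (-x ^ 2 / 2)) (-x * Real.exp (-x ^ 2 / 2)) x := by
  have h : HasDerivAt (fun x : ℝ => -x ^ 2 / 2) (-x) x := by
    refine (((hasDerivAt_pow 2 x).neg.div_const 2)).congr_deriv ?_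
    push_cast
    ring
  exact h.exp.congr_deriv (by ring)

lemma hasDerivAt_pcU {ν : ℝ} (hν : 0 < ν) (x : ℝ) : HasDerivAt (pcU ν) (pcV ν x) x := by
  refine ((hasDerivAt_exp_neg_sq_div_two x).mul (hasDerivAt_pcF hν x)).congr_deriv ?_
  unfold pcV
  ring

lemma hasDerivAt_pcV {ν : ℝ} (hν : 0 < ν) (x : ℝ) :
    HasDerivAt (pcV ν) ((x ^ 2 - (1 - 2 * ν)) * pcU ν x) x := by
  have h1 := hasDerivAt_pcF (show 0 < ν + 1 by linarith) x
  rw [add_assoc, one_add_one_eq_two] at h1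
  refine ((hasDerivAt_exp_neg_sq_div_two x).mul
    ((((hasDerivAt_id x).neg).mul (hasDerivAt_pcF hν x)).sub h1)).congr_deriv ?_
  simp only [id, Pi.mul_apply, Pi.sub_apply, Pi.neg_apply]
  unfold pcU
  linear_combination (-2 * Real.exp (-x ^ 2 / 2)) * mul_pcF hν x

lemma hasDerivAt_pcF_ratio {ν : ℝ} (hν : 0 < ν) (x : ℝ) :
    HasDerivAt (fun x => pcF (ν + 1) x / pcF ν x)
      ((pcF (ν + 1) x ^ 2 - pcF ν x * pcF (ν + 2) x) / pcF ν x ^ 2) x := by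
  have h1 := hasDerivAt_pcF (show 0 < ν + 1 by linarith) x
  rw [add_assoc, one_add_one_eq_two] at h1
  exact (h1.div (hasDerivAt_pcF hν x) (pcF_pos hν x).ne').congr_deriv (by ring)

lemma pcF_ratio_antitone {ν : ℝ} (hν : 0 < ν) : Antitone fun x => pcF (ν + 1) x / pcF ν x :=
  antitone_of_hasDerivAt_nonpos (hasDerivAt_pcF_ratio hν) fun x =>
    div_nonpos_of_nonpos_of_nonneg (sub_nonpos.2 (sq_pcF_add_one_le hν x)) (sq_nonneg _)

/-- The Riccati equation for the logarithmic derivative. -/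
lemma hasDerivAt_pcG {ν : ℝ} (hν : 0 < ν) (x : ℝ) :
    HasDerivAt (pcG ν) (x ^ 2 - (1 - 2 * ν) - pcG ν x ^ 2) x := by
  refine ((hasDerivAt_id x).neg.sub (hasDerivAt_pcF_ratio hν x)).congr_deriv ?_
  have h0 := (pcF_pos hν x).ne'
  unfold pcG
  field_simp
  linear_combination (-2 * pcF ν x) * mul_pcF hν x

lemma pcW_eq {ν : ℝ} (hν : 0 < ν) (x : ℝ) :
    pcW ν x = pcU ν x ^ 2 * (x ^ 2 - (1 - 2 * ν) - pcG ν x ^ 2) := by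
  rw [pcW, pcV_eq hν]
  ring

lemma hasDerivAt_pcW {ν : ℝ} (hν : 0 < ν) (x : ℝ) :
    HasDerivAt (pcW ν) (2 * x * pcU ν x ^ 2) x := by
  have h := ((((hasDerivAt_pow 2 x).sub_const (1 - 2 * ν)).mul ((hasDerivAt_pcU hν x).pow 2)).sub
    ((hasDerivAt_pcV hν x).pow 2))
  refine h.congr_deriv ?_
  simp only [Pi.pow_apply]
  push_cast
  ring

lemma exists_tendsto_pcF {ν : ℝ} (hν : 0 < ν) : ∃ l, Tendsto (pcF ν) atTop (nhds l) :=
  ⟨_, tendsto_atTop_ciInf (pcF_antitone hν) ⟨0, by rintro _ ⟨x, rfl⟩; exact (pcF_pos hν x).le⟩⟩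

lemma tendsto_exp_neg_sq : Tendsto (fun x : ℝ => Real.exp (-x ^ 2)) atTop (nhds 0) :=
  Real.tendsto_exp_neg_atTop_nhds_zero.comp (tendsto_pow_atTop two_ne_zero)

lemma tendsto_mul_exp_neg_sq : Tendsto (fun x : ℝ => x * Real.exp (-x ^ 2)) atTop (nhds 0) := by
  have h := (tendsto_rpow_abs_mul_exp_neg_mul_sq_cocompact one_pos 1).mono_left
    atTop_le_cocompact
  refine h.congr' ?_
  filter_upwards [eventually_ge_atTop 0] with x hx
  rw [Real.rpow_one, abs_of_nonneg hx, neg_one_mul]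

lemma exp_neg_sq_eq (x : ℝ) : Real.exp (-x ^ 2) = Real.exp (-x ^ 2 / 2) ^ 2 := by
  rw [← Real.exp_nat_mul]
  congr 1
  push_cast
  ring

lemma tendsto_pcU_mul_pcV {ν : ℝ} (hν : 0 < ν) :
    Tendsto (fun x => pcU ν x * pcV ν x) atTop (nhds 0) := by
  obtain ⟨l, hl⟩ := exists_tendsto_pcF hν
  obtain ⟨k, hk⟩ := exists_tendsto_pcF (show 0 < ν + 1 by linarith)
  have h := ((tendsto_mul_exp_neg_sq.mul (hl.pow 2)).neg).sub
    (tendsto_exp_neg_sq.mul (hl.mul hk))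
  simp only [zero_mul, neg_zero, sub_zero] at h
  refine h.congr fun x => ?_
  rw [exp_neg_sq_eq]
  unfold pcU pcV
  ring

lemma tendsto_pcW {ν : ℝ} (hν : 0 < ν) : Tendsto (pcW ν) atTop (nhds 0) := by
  obtain ⟨l, hl⟩ := exists_tendsto_pcF hν
  obtain ⟨k, hk⟩ := exists_tendsto_pcF (show 0 < ν + 1 by linarith)
  have h := (tendsto_mul_exp_neg_sq.mul ((hl.mul hk).const_mul (-2))).add
    (tendsto_exp_neg_sq.mul (((hl.pow 2).const_mul (2 * ν - 1)).sub (hk.pow 2)))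
  simp only [zero_mul, add_zero] at h
  refine h.congr fun x => ?_
  rw [exp_neg_sq_eq]
  unfold pcW pcU pcV
  ring

lemma pcW_strictMonoOn {ν : ℝ} (hν : 0 < ν) : StrictMonoOn (pcW ν) (Ici 0) := by
  refine strictMonoOn_of_deriv_pos (convex_Ici 0)
    (fun x _ => (hasDerivAt_pcW hν x).continuousAt.continuousWithinAt) fun x hx => ?_
  rw [interior_Ici] at hx
  have hx : 0 < x := hx
  have := pcU_pos hν x
  rw [(hasDerivAt_pcW hν x).deriv]
  positivity

lemma pcW_antitoneOn {ν : ℝ} (hν : 0 < ν) : AntitoneOn (pcW ν) (Iic 0) := by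
  refine antitoneOn_of_deriv_nonpos (convex_Iic 0)
    (fun x _ => (hasDerivAt_pcW hν x).continuousAt.continuousWithinAt)
    (fun x _ => (hasDerivAt_pcW hν x).differentiableAt.differentiableWithinAt) fun x hx => ?_
  rw [interior_Iic] at hx
  have hx : x < 0 := hx
  rw [(hasDerivAt_pcW hν x).deriv]
  nlinarith [sq_nonneg (pcU ν x)]

lemma pcW_neg {ν : ℝ} (hν : 0 < ν) {x : ℝ} (hx : 0 ≤ x) : pcW ν x < 0 := by
  have h1 : pcW ν x < pcW ν (x + 1) :=
    pcW_strictMonoOn hν hx (show (0:ℝ) ≤ x + 1 by linarith) (by linarith)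
  refine h1.trans_le (ge_of_tendsto (tendsto_pcW hν) ?_)
  filter_upwards [eventually_ge_atTop (x + 1)] with z hz
  exact (pcW_strictMonoOn hν).monotoneOn (show (0:ℝ) ≤ x + 1 by linarith)
    (show (0:ℝ) ≤ z by linarith) hz

/-- A critical point of `pcG ν` on the negative half-line is a global maximum. -/
lemma pcG_le_of_critical {ν x : ℝ} (hν : 0 < ν) (hx : x < 0)
    (hcrit : x ^ 2 - (1 - 2 * ν) - pcG ν x ^ 2 = 0) (y : ℝ) : pcG ν y ≤ pcG ν x := by
  have hW : pcW ν x = 0 := by rw [pcW_eq hν, hcrit, mul_zero]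
  have hUpos := pcU_pos hν
  rcases le_total y x with hyx | hxy
  · have hmono : MonotoneOn (pcG ν) (Iic x) := by
      refine monotoneOn_of_deriv_nonneg (convex_Iic x)
        (fun z _ => (hasDerivAt_pcG hν z).continuousAt.continuousWithinAt)
        (fun z _ => (hasDerivAt_pcG hν z).differentiableAt.differentiableWithinAt) fun z hz => ?_
      rw [interior_Iic] at hz
      have hz : z < x := hz
      have h := pcW_antitoneOn hν (show z ≤ 0 by linarith) hx.le hz.le
      rw [hW, pcW_eq hν] at h
      rw [(hasDerivAt_pcG hν z).deriv]
      exact nonneg_of_mul_nonneg_right h (pow_pos (hUpos z) 2)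
    exact hmono hyx self_mem_Iic hyx
  · have hanti : AntitoneOn (pcG ν) (Ici x) := by
      refine antitoneOn_of_deriv_nonpos (convex_Ici x)
        (fun z _ => (hasDerivAt_pcG hν z).continuousAt.continuousWithinAt)
        (fun z _ => (hasDerivAt_pcG hν z).differentiableAt.differentiableWithinAt) fun z hz => ?_
      rw [interior_Ici] at hz
      have hz : x < z := hz
      have h : pcW ν z ≤ 0 := by
        rcases le_total z 0 with hz0 | hz0
        · exact hW ▸ pcW_antitoneOn hν hx.le hz0 hz.le
        · exact (pcW_neg hν hz0).le
      rw [pcW_eq hν] at h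
      rw [(hasDerivAt_pcG hν z).deriv]
      exact nonpos_of_mul_nonpos_right h (pow_pos (hUpos z) 2)
    exact hanti self_mem_Ici hxy hxy

/-- Completing the square: a solution `f` of the Riccati equation bounds the energy below. -/
lemma riccati_le_integral {f f' a' : ℝ → ℝ} (hf : ∀ t, HasDerivAt f (f' t) t)
    (hf' : Continuous f') {T : ℝ} (hT : 0 ≤ T) (c : ℝ) (ha' : IntervalIntegrable a' volume 0 T)
    (ha2 : IntervalIntegrable (fun t => a' t ^ 2) volume 0 T) :
    f T * (c + ∫ s in (0:ℝ)..T, a' s) ^ 2 - f 0 * c ^ 2 ≤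
      ∫ t in (0:ℝ)..T, (a' t ^ 2 + (f' t + f t ^ 2) * (c + ∫ s in (0:ℝ)..t, a' s) ^ 2) := by
  set a : ℝ → ℝ := fun t => c + ∫ s in (0:ℝ)..t, a' s with ha
  have hfc : ContDiff ℝ 1 f := by
    rw [contDiff_one_iff_deriv]
    exact ⟨fun t => (hf t).differentiableAt, by rwa [funext fun t => (hf t).deriv]⟩
  have hfac : AbsolutelyContinuousOnInterval f 0 T :=
    hfc.contDiffOn.absolutelyContinuousOnInterval
  have haac : AbsolutelyContinuousOnInterval a 0 T :=
    (contDiff_const.contDiffOn (n := 1)).absolutelyContinuousOnInterval.fun_add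
      (ha'.absolutelyContinuousOnInterval_intervalIntegral left_mem_uIcc)
  have hac : ContinuousOn a (uIcc 0 T) := haac.continuousOn
  have hpac : AbsolutelyContinuousOnInterval (fun t => f t * (a t * a t)) 0 T :=
    hfac.fun_mul (haac.fun_mul haac)
  have hder : ∀ᵐ t, t ∈ uIcc 0 T →
      deriv (fun t => f t * (a t * a t)) t = f' t * (a t * a t) + 2 * f t * a t * a' t := by
    filter_upwards [ha'.ae_hasDerivAt_integral] with t ht hmem
    have h1 : HasDerivAt a (a' t) t := (ht hmem 0 left_mem_uIcc).const_add c
    have h2 : HasDerivAt (fun t => f t * (a t * a t)) _ t := (hf t).mul (h1.mul h1)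
    rw [h2.deriv]
    ring
  have hftc := hpac.integral_deriv_eq_sub
  have ha0 : a 0 = c := by simp [ha]
  have key : f T * a T ^ 2 - f 0 * c ^ 2 =
      ∫ t in (0:ℝ)..T, deriv (fun t => f t * (a t * a t)) t := by
    rw [hftc, ha0]
    ring
  have hcont : ContinuousOn (fun t => (f' t + f t ^ 2) * a t ^ 2) (uIcc 0 T) :=
    ((hf'.add (hfc.continuous.pow 2)).continuousOn).mul (hac.pow 2)
  change f T * a T ^ 2 - f 0 * c ^ 2 ≤ ∫ t in (0:ℝ)..T, (a' t ^ 2 + (f' t + f t ^ 2) * a t ^ 2)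
  rw [key]
  refine intervalIntegral.integral_mono_ae_restrict hT hpac.intervalIntegrable_deriv
    (ha2.add hcont.intervalIntegrable) ?_
  rw [EventuallyLE, ae_restrict_iff' measurableSet_Icc]
  filter_upwards [hder] with t ht hmem
  rw [ht (by rwa [uIcc_of_le hT])]
  nlinarith [sq_nonneg (a' t - f t * a t)]

lemma AdmissibleHL.riccati_le_integral {u u' : ℝ → ℂ} (hu : AdmissibleHL u u') {f f' : ℝ → ℝ}
    (hf : ∀ t, HasDerivAt f (f' t) t) (hf' : Continuous f') {T : ℝ} (hT : 0 ≤ T) :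
    f T * ‖u T‖ ^ 2 - f 0 * ‖u 0‖ ^ 2 ≤
      ∫ t in (0:ℝ)..T, (‖u' t‖ ^ 2 + (f' t + f t ^ 2) * ‖u t‖ ^ 2) := by
  have h_int := hu.locInt T hT
  have hre : IntervalIntegrable (fun t => (u' t).re) volume 0 T := ⟨h_int.1.re, h_int.2.re⟩
  have him : IntervalIntegrable (fun t => (u' t).im) volume 0 T := ⟨h_int.1.im, h_int.2.im⟩
  have hn : IntervalIntegrable (fun t => ‖u' t‖ ^ 2) volume 0 T :=
    (intervalIntegrable_iff_integrableOn_Ioc_of_le hT).2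
      (hu.memL2'.mono_set Ioc_subset_Ioi_self)
  have hsq (z : ℂ) : ‖z‖ ^ 2 = z.re ^ 2 + z.im ^ 2 := by
    rw [Complex.sq_norm, Complex.normSq_apply]
    ring
  have hre2 : IntervalIntegrable (fun t => (u' t).re ^ 2) volume 0 T := by
    refine hn.mono_fun (hre.aestronglyMeasurable_restrict_uIoc.pow 2) (ae_of_all _ fun t => ?_)
    beta_reduce
    rw [norm_pow, norm_pow, norm_norm, Real.norm_eq_abs, sq_abs, hsq]
    nlinarith [sq_nonneg (u' t).im]
  have him2 : IntervalIntegrable (fun t => (u' t).im ^ 2) volume 0 T := by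
    refine hn.mono_fun (him.aestronglyMeasurable_restrict_uIoc.pow 2) (ae_of_all _ fun t => ?_)
    beta_reduce
    rw [norm_pow, norm_pow, norm_norm, Real.norm_eq_abs, sq_abs, hsq]
    nlinarith [sq_nonneg (u' t).re]
  have hure : ∀ t ∈ Icc 0 T, (u t).re = (u 0).re + ∫ s in (0:ℝ)..t, (u' s).re := by
    intro t ht
    have h := intervalIntegral.intervalIntegral_re (hu.locInt t ht.1)
    rw [hu.ac t ht.1, Complex.add_re]
    simpa using h.symm
  have huim : ∀ t ∈ Icc 0 T, (u t).im = (u 0).im + ∫ s in (0:ℝ)..t, (u' s).im := by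
    intro t ht
    have h := intervalIntegral.intervalIntegral_im (hu.locInt t ht.1)
    rw [hu.ac t ht.1, Complex.add_im]
    simpa using h.symm
  have hfcont : Continuous f := continuous_iff_continuousAt.2 fun t => (hf t).continuousAt
  have huc : ContinuousOn u (uIcc 0 T) := hu.cont.mono (by
    rw [uIcc_of_le hT]
    exact Icc_subset_Ici_self)
  have hF : ContinuousOn (fun t => f' t + f t ^ 2) (uIcc 0 T) :=
    (hf'.add (hfcont.pow 2)).continuousOn
  have ire : IntervalIntegrable
      (fun t => (u' t).re ^ 2 + (f' t + f t ^ 2) * (u t).re ^ 2) volume 0 T :=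
    hre2.add (hF.mul ((Complex.continuous_re.comp_continuousOn huc).pow 2)).intervalIntegrable
  have iim : IntervalIntegrable
      (fun t => (u' t).im ^ 2 + (f' t + f t ^ 2) * (u t).im ^ 2) volume 0 T :=
    him2.add (hF.mul ((Complex.continuous_im.comp_continuousOn huc).pow 2)).intervalIntegrable
  have kre := _root_.riccati_le_integral hf hf' hT (u 0).re hre hre2
  have kim := _root_.riccati_le_integral hf hf' hT (u 0).im him him2
  rw [← hure T (right_mem_Icc.2 hT), intervalIntegral.integral_congr
    (g := fun t => (u' t).re ^ 2 + (f' t + f t ^ 2) * (u t).re ^ 2) (fun t ht => by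
      rw [uIcc_of_le hT] at ht
      simp only [hure t ht])] at kre
  rw [← huim T (right_mem_Icc.2 hT), intervalIntegral.integral_congr
    (g := fun t => (u' t).im ^ 2 + (f' t + f t ^ 2) * (u t).im ^ 2) (fun t ht => by
      rw [uIcc_of_le hT] at ht
      simp only [huim t ht])] at kim
  have hsum : ∫ t in (0:ℝ)..T, (‖u' t‖ ^ 2 + (f' t + f t ^ 2) * ‖u t‖ ^ 2) =
      (∫ t in (0:ℝ)..T, ((u' t).re ^ 2 + (f' t + f t ^ 2) * (u t).re ^ 2)) +
        ∫ t in (0:ℝ)..T, ((u' t).im ^ 2 + (f' t + f t ^ 2) * (u t).im ^ 2) := by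
    rw [← intervalIntegral.integral_add ire iim]
    congr 1
    funext t
    rw [hsq, hsq]
    ring
  rw [hsum, hsq, hsq]
  linarith

/-- An integrable function on a half-line is not eventually at least a positive constant. -/
lemma not_eventually_le_of_integrableOn_Ioi {h : ℝ → ℝ} (hh : IntegrableOn h (Ioi 0)) {δ : ℝ}
    (hδ : 0 < δ) : ¬ ∀ᶠ t in atTop, δ ≤ h t := by
  intro hev
  obtain ⟨N, hN⟩ := eventually_atTop.1 (hev.and (eventually_gt_atTop 0))
  have hc : IntegrableOn (fun _ : ℝ => δ) (Ioi N) := by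
    refine Integrable.mono' (hh.mono_set (Ioi_subset_Ioi (hN N le_rfl).2.le))
      aestronglyMeasurable_const ?_
    filter_upwards [ae_restrict_mem measurableSet_Ioi] with t ht
    rw [Real.norm_of_nonneg hδ.le]
    exact (hN t (le_of_lt ht)).1
  rw [integrableOn_const_iff] at hc
  simp [hδ.ne'] at hc

lemma AdmissibleHL.integrableOn_sub_sq {u u' : ℝ → ℂ} (hu : AdmissibleHL u u') (ξ : ℝ) :
    IntegrableOn (fun t => (t - ξ) ^ 2 * ‖u t‖ ^ 2) (Ioi 0) := by
  have hm : AEStronglyMeasurable u (volume.restrict (Ioi 0)) :=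
    (hu.cont.mono Ioi_subset_Ici_self).aestronglyMeasurable measurableSet_Ioi
  have hb : IntegrableOn (fun t => 2 * (t ^ 2 * ‖u t‖ ^ 2) + 2 * ξ ^ 2 * ‖u t‖ ^ 2) (Ioi 0) :=
    (hu.memL2t.const_mul 2).add (hu.memL2.const_mul (2 * ξ ^ 2))
  refine hb.mono' ?_ (ae_of_all _ fun t => ?_)
  · exact (by fun_prop : Continuous fun t : ℝ => (t - ξ) ^ 2).aestronglyMeasurable.mul
      (hm.norm.pow 2)
  · rw [Real.norm_of_nonneg (by positivity)]
    nlinarith [mul_nonneg (sq_nonneg (t + ξ)) (sq_nonneg ‖u t‖)]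

lemma AdmissibleHL.le_qform {u u' : ℝ → ℂ} (hu : AdmissibleHL u u') {ν γ ξ : ℝ} (hν : 0 < ν)
    (hγ : pcG ν (-ξ) ≤ γ) :
    (1 - 2 * ν) * ∫ t in Ioi (0:ℝ), ‖u t‖ ^ 2 ≤ qform γ ξ u u' := by
  have hf (t : ℝ) : HasDerivAt (fun t => pcG ν (t - ξ))
      ((t - ξ) ^ 2 - (1 - 2 * ν) - pcG ν (t - ξ) ^ 2) t :=
    (hasDerivAt_pcG hν (t - ξ)).comp_sub_const t ξ
  have hGc : Continuous fun t => pcG ν (t - ξ) :=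
    continuous_iff_continuousAt.2 fun t => (hf t).continuousAt
  have hf' : Continuous fun t => (t - ξ) ^ 2 - (1 - 2 * ν) - pcG ν (t - ξ) ^ 2 := by fun_prop
  have hI : IntegrableOn (fun t => ‖u' t‖ ^ 2 + (t - ξ) ^ 2 * ‖u t‖ ^ 2) (Ioi 0) :=
    hu.memL2'.add (hu.integrableOn_sub_sq ξ)
  have hJ : IntegrableOn (fun t => ‖u' t‖ ^ 2 + ((t - ξ) ^ 2 - (1 - 2 * ν)) * ‖u t‖ ^ 2)
      (Ioi 0) := by
    refine (hI.sub (hu.memL2.const_mul (1 - 2 * ν))).congr (ae_of_all _ fun t => ?_)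
    simp only [Pi.sub_apply]
    ring
  have hJval : ∫ t in Ioi (0:ℝ), (‖u' t‖ ^ 2 + ((t - ξ) ^ 2 - (1 - 2 * ν)) * ‖u t‖ ^ 2) =
      (∫ t in Ioi (0:ℝ), (‖u' t‖ ^ 2 + (t - ξ) ^ 2 * ‖u t‖ ^ 2)) -
        (1 - 2 * ν) * ∫ t in Ioi (0:ℝ), ‖u t‖ ^ 2 := by
    rw [← integral_const_mul, ← integral_sub hI (hu.memL2.const_mul (1 - 2 * ν))]
    congr 1
    funext t
    ring
  set J := ∫ t in Ioi (0:ℝ), (‖u' t‖ ^ 2 + ((t - ξ) ^ 2 - (1 - 2 * ν)) * ‖u t‖ ^ 2) with hJdef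
  have hlim := intervalIntegral_tendsto_integral_Ioi (0:ℝ) hJ tendsto_id
  have hstep (T : ℝ) (hT : 0 ≤ T) : pcG ν (T - ξ) * ‖u T‖ ^ 2 - pcG ν (-ξ) * ‖u 0‖ ^ 2 ≤
      ∫ t in (0:ℝ)..T, (‖u' t‖ ^ 2 + ((t - ξ) ^ 2 - (1 - 2 * ν)) * ‖u t‖ ^ 2) := by
    have := hu.riccati_le_integral hf hf' hT
    simpa only [zero_sub, sub_add_cancel] using this
  have hlow : -(pcG ν (-ξ) * ‖u 0‖ ^ 2) ≤ J := by
    by_contra! hlt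
    set δ := (-(pcG ν (-ξ) * ‖u 0‖ ^ 2) - J) / 2 with hδ
    have hδ0 : 0 < δ := by linarith
    set r := pcF (ν + 1) (-ξ) / pcF ν (-ξ) with hr
    have hr0 : 0 < r := div_pos (pcF_pos (by linarith) _) (pcF_pos hν _)
    have hK : IntegrableOn (fun t => (1 + r) * ‖u t‖ ^ 2 + (t - ξ) ^ 2 * ‖u t‖ ^ 2) (Ioi 0) :=
      (hu.memL2.const_mul (1 + r)).add (hu.integrableOn_sub_sq ξ)
    refine not_eventually_le_of_integrableOn_Ioi hK hδ0 ?_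
    filter_upwards [hlim.eventually_lt_const (show J < J + δ by linarith),
      eventually_ge_atTop 0] with T hT hT0
    have h1 := hstep T hT0
    have h2 : pcF (ν + 1) (T - ξ) / pcF ν (T - ξ) ≤ r :=
      pcF_ratio_antitone hν (by linarith : -ξ ≤ T - ξ)
    have h3 : -(1 + r + (T - ξ) ^ 2) ≤ pcG ν (T - ξ) := by
      unfold pcG
      nlinarith [sq_nonneg (T - ξ - 1)]
    have h4 := mul_le_mul_of_nonneg_right h3 (sq_nonneg ‖u T‖)
    simp only [id] at hT
    linarith
  have := mul_le_mul_of_nonneg_right hγ (sq_nonneg ‖u 0‖)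
  rw [qform]
  linarith

lemma integrable_quadratic_mul_exp_neg_sq (a b ξ : ℝ) :
    Integrable fun t : ℝ => (a * (t - ξ) ^ 2 + b) * Real.exp (-(t - ξ) ^ 2) := by
  have h0 : Integrable fun y : ℝ => Real.exp (-y ^ 2) := by
    simpa using integrable_exp_neg_mul_sq (b := 1) one_pos
  have h2 : Integrable fun y : ℝ => y ^ 2 * Real.exp (-y ^ 2) := by
    simpa using integrable_rpow_mul_exp_neg_mul_sq (b := 1) one_pos (s := 2) (by norm_num)
  have h : Integrable fun y : ℝ => (a * y ^ 2 + b) * Real.exp (-y ^ 2) := by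
    refine ((h2.const_mul a).add (h0.const_mul b)).congr (ae_of_all _ fun y => ?_)
    simp only [Pi.add_apply]
    ring
  exact h.comp_sub_right ξ

lemma integrableOn_Ioi_of_le_quadratic_mul_exp {h : ℝ → ℝ} (hc : Continuous h) (h0 : ∀ t, 0 ≤ h t)
    {a b ξ : ℝ} (hle : ∀ t, 0 < t → h t ≤ (a * (t - ξ) ^ 2 + b) * Real.exp (-(t - ξ) ^ 2)) :
    IntegrableOn h (Ioi 0) := by
  refine (integrable_quadratic_mul_exp_neg_sq a b ξ).integrableOn.mono'
    hc.aestronglyMeasurable ?_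
  filter_upwards [ae_restrict_mem measurableSet_Ioi] with t ht
  rw [Real.norm_of_nonneg (h0 t)]
  exact hle t ht

lemma continuous_pcU {ν : ℝ} (hν : 0 < ν) : Continuous (pcU ν) :=
  continuous_iff_continuousAt.2 fun x => (hasDerivAt_pcU hν x).continuousAt

lemma continuous_pcV {ν : ℝ} (hν : 0 < ν) : Continuous (pcV ν) :=
  continuous_iff_continuousAt.2 fun x => (hasDerivAt_pcV hν x).continuousAt

lemma admissibleHL_pcU {ν : ℝ} (hν : 0 < ν) (ξ : ℝ) :
    AdmissibleHL (fun t => (pcU ν (t - ξ) : ℂ)) (fun t => (pcV ν (t - ξ) : ℂ)) := by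
  have hUc : Continuous fun t => pcU ν (t - ξ) := (continuous_pcU hν).comp (by fun_prop)
  have hVc : Continuous fun t => pcV ν (t - ξ) := (continuous_pcV hν).comp (by fun_prop)
  have hν1 : 0 < ν + 1 := by linarith
  set A := pcF ν (-ξ) with hA
  set B := pcF (ν + 1) (-ξ) with hB
  have hFA (t : ℝ) (ht : 0 < t) : pcF ν (t - ξ) ^ 2 ≤ A ^ 2 :=
    pow_le_pow_left₀ (pcF_pos hν _).le (pcF_antitone hν (by linarith)) 2
  have hFB (t : ℝ) (ht : 0 < t) : pcF (ν + 1) (t - ξ) ^ 2 ≤ B ^ 2 :=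
    pow_le_pow_left₀ (pcF_pos hν1 _).le (pcF_antitone hν1 (by linarith)) 2
  have hU2 (t : ℝ) : pcU ν (t - ξ) ^ 2 = pcF ν (t - ξ) ^ 2 * Real.exp (-(t - ξ) ^ 2) := by
    rw [exp_neg_sq_eq, pcU]
    ring
  have hV2 (t : ℝ) : pcV ν (t - ξ) ^ 2 =
      (-(t - ξ) * pcF ν (t - ξ) - pcF (ν + 1) (t - ξ)) ^ 2 * Real.exp (-(t - ξ) ^ 2) := by
    rw [exp_neg_sq_eq, pcV]
    ring
  refine ⟨?_, ?_, ?_, ?_, ?_, ?_⟩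
  · exact (Complex.continuous_ofReal.comp hUc).continuousOn
  · exact fun t _ => (Complex.continuous_ofReal.comp hVc).intervalIntegrable 0 t
  · intro t _
    rw [intervalIntegral.integral_ofReal, intervalIntegral.integral_eq_sub_of_hasDerivAt
      (fun s _ => (hasDerivAt_pcU hν (s - ξ)).comp_sub_const s ξ) (hVc.intervalIntegrable 0 t)]
    push_cast
    ring
  · simp only [Complex.norm_real, Real.norm_eq_abs, sq_abs]
    refine integrableOn_Ioi_of_le_quadratic_mul_exp (a := 0) (b := A ^ 2) (ξ := ξ)
      (by fun_prop) (fun t => sq_nonneg _) fun t ht => ?_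
    rw [hU2]
    exact mul_le_mul_of_nonneg_right (by linarith [hFA t ht]) (Real.exp_pos _).le
  · simp only [Complex.norm_real, Real.norm_eq_abs, sq_abs]
    refine integrableOn_Ioi_of_le_quadratic_mul_exp (a := 2 * A ^ 2) (b := 2 * B ^ 2) (ξ := ξ)
      (by fun_prop) (fun t => sq_nonneg _) fun t ht => ?_
    rw [hV2]
    refine mul_le_mul_of_nonneg_right ?_ (Real.exp_pos _).le
    have := mul_le_mul_of_nonneg_left (hFA t ht) (sq_nonneg (t - ξ))
    nlinarith [hFB t ht, sq_nonneg ((t - ξ) * pcF ν (t - ξ) - pcF (ν + 1) (t - ξ))]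
  · simp only [Complex.norm_real, Real.norm_eq_abs, sq_abs]
    refine integrableOn_Ioi_of_le_quadratic_mul_exp (a := 2 * A ^ 2) (b := 2 * ξ ^ 2 * A ^ 2)
      (ξ := ξ) (by fun_prop) (fun t => by positivity) fun t ht => ?_
    rw [hU2, ← mul_assoc]
    refine mul_le_mul_of_nonneg_right ?_ (Real.exp_pos _).le
    have := mul_le_mul_of_nonneg_left (hFA t ht) (sq_nonneg t)
    nlinarith [mul_nonneg (sq_nonneg A) (sq_nonneg (t - 2 * ξ))]

lemma qform_pcU {ν : ℝ} (hν : 0 < ν) (ξ : ℝ) :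
    qform (pcG ν (-ξ)) ξ (fun t => (pcU ν (t - ξ) : ℂ)) (fun t => (pcV ν (t - ξ) : ℂ)) =
      (1 - 2 * ν) * ∫ t in Ioi (0:ℝ), ‖(pcU ν (t - ξ) : ℂ)‖ ^ 2 := by
  have hadm := admissibleHL_pcU hν ξ
  have i1 := hadm.memL2'.add (hadm.integrableOn_sub_sq ξ)
  have i2 := hadm.memL2.const_mul (1 - 2 * ν)
  have hsub := integral_sub i1 i2
  simp only [Complex.norm_real, Real.norm_eq_abs, sq_abs, Pi.add_apply] at i1 i2 hsub
  have hd (t : ℝ) : HasDerivAt (fun t => pcU ν (t - ξ) * pcV ν (t - ξ))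
      (pcV ν (t - ξ) ^ 2 + (t - ξ) ^ 2 * pcU ν (t - ξ) ^ 2 -
        (1 - 2 * ν) * pcU ν (t - ξ) ^ 2) t := by
    refine (((hasDerivAt_pcU hν (t - ξ)).comp_sub_const t ξ).mul
      ((hasDerivAt_pcV hν (t - ξ)).comp_sub_const t ξ)).congr_deriv ?_
    ring
  have hlim : Tendsto (fun t => pcU ν (t - ξ) * pcV ν (t - ξ)) atTop (nhds 0) :=
    (tendsto_pcU_mul_pcV hν).comp (tendsto_atTop_add_const_right _ (-ξ) tendsto_id)
  have h_int := integral_Ioi_of_hasDerivAt_of_tendsto' (a := 0) (fun t _ => hd t) (i1.sub i2) hlim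
  rw [hsub, integral_const_mul, zero_sub, zero_sub, pcV_eq hν] at h_int
  simp only [qform, Complex.norm_real, Real.norm_eq_abs, sq_abs, zero_sub]
  linarith

lemma AdmissibleHL.integral_norm_sq_pos_s15 {u u' : ℝ → ℂ} (hu : AdmissibleHL u u')
    (h0 : ∃ t ∈ Ici (0:ℝ), u t ≠ 0) : 0 < ∫ t in Ioi (0:ℝ), ‖u t‖ ^ 2 := by
  refine lt_of_le_of_ne (integral_nonneg fun t => sq_nonneg _) fun heq => ?_
  have hz := (setIntegral_eq_zero_iff_of_nonneg_ae (ae_of_all _ fun t => sq_nonneg _)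
    hu.memL2).1 heq.symm
  have hEq : EqOn u 0 (Ici 0) := by
    have hae : u =ᵐ[volume.restrict (Ioi 0)] 0 := by
      filter_upwards [hz] with t ht
      simpa using ht
    have h1 : EqOn u 0 (Ioi 0) :=
      Measure.eqOn_open_of_ae_eq hae isOpen_Ioi (hu.cont.mono Ioi_subset_Ici_self)
        continuousOn_const
    exact h1.of_subset_closure hu.cont continuousOn_const Ioi_subset_Ici_self
      (by rw [closure_Ioi])
  obtain ⟨t, ht, hne⟩ := h0
  exact hne (hEq ht)

/-- The value of `Θ(γ)` from a solution of the stationarity equations. -/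
lemma Theta_eq_of_pcG_eq {ν γ x : ℝ} (hν : 0 < ν) (hx : x < 0) (hG : pcG ν x = γ)
    (hθ : 1 - 2 * ν = x ^ 2 - γ ^ 2) : Theta γ = x ^ 2 - γ ^ 2 := by
  have hmax (ξ : ℝ) : pcG ν (-ξ) ≤ γ := by
    rw [← hG]
    exact pcG_le_of_critical hν hx (by rw [hG, hθ]; ring) (-ξ)
  have hlow (ξ : ℝ) : 1 - 2 * ν ∈ lowerBounds { r : ℝ | ∃ u u' : ℝ → ℂ, AdmissibleHL u u' ∧
      (∃ t ∈ Ici (0:ℝ), u t ≠ 0) ∧ r = qform γ ξ u u' / ∫ t in Ioi (0:ℝ), ‖u t‖ ^ 2 } := by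
    rintro r ⟨u, u', hu, h0, rfl⟩
    rw [le_div_iff₀ (hu.integral_norm_sq_pos_s15 h0)]
    exact hu.le_qform hν (hmax ξ)
  have hne (ξ : ℝ) : ∃ t ∈ Ici (0:ℝ), (pcU ν (t - ξ) : ℂ) ≠ 0 :=
    ⟨0, mem_Ici.2 le_rfl, Complex.ofReal_ne_zero.2 (pcU_pos hν _).ne'⟩
  have hmu (ξ : ℝ) : 1 - 2 * ν ≤ mu1 γ ξ :=
    le_csInf ⟨_, _, _, admissibleHL_pcU hν ξ, hne ξ, rfl⟩ (hlow ξ)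
  have hatt : mu1 γ (-x) ≤ 1 - 2 * ν := by
    refine csInf_le ⟨_, hlow _⟩ ⟨_, _, admissibleHL_pcU hν (-x), hne _, ?_⟩
    have hq := qform_pcU hν (-x)
    rw [neg_neg, hG] at hq
    rw [hq, mul_div_cancel_right₀ _ ((admissibleHL_pcU hν (-x)).integral_norm_sq_pos_s15 (hne _)).ne']
  rw [← hθ]
  exact le_antisymm ((ciInf_le ⟨_, forall_mem_range.2 hmu⟩ (-x)).trans hatt) (le_ciInf hmu)

/-- The left-hand side of the equation in `x` characterising the optimal parameter `ξ = -x`. -/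
noncomputable def pcPsi (p : ℝ × ℝ) : ℝ :=
  (p.2 + p.1) * pcF ((1 - p.2 ^ 2 + p.1 ^ 2) / 2) p.2 +
    pcF ((1 - p.2 ^ 2 + p.1 ^ 2) / 2 + 1) p.2

lemma Theta_eq_of_pcPsi_eq_zero {γ x : ℝ} (hν : 0 < 1 - x ^ 2 + γ ^ 2) (hx : x < 0)
    (h : pcPsi (γ, x) = 0) : Theta γ = x ^ 2 - γ ^ 2 := by
  have hν' : 0 < (1 - x ^ 2 + γ ^ 2) / 2 := by linarith
  refine Theta_eq_of_pcG_eq hν' hx ?_ (by ring)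
  simp only [pcPsi] at h
  have hF := (pcF_pos hν' x).ne'
  rw [pcG, eq_neg_of_add_eq_zero_right h]
  field_simp
  ring

lemma exists_pcPsi_eq_zero (γ : ℝ) : ∃ x < 0, 0 < 1 - x ^ 2 + γ ^ 2 ∧ pcPsi (γ, x) = 0 := by
  set r := √(1 + γ ^ 2) with hr
  have hr2 : r ^ 2 = 1 + γ ^ 2 := Real.sq_sqrt (by positivity)
  have hr0 : 0 < r := Real.sqrt_pos.2 (by positivity)
  set N : ℝ → ℝ := fun x => (1 - x ^ 2 + γ ^ 2) / 2 with hN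
  set K : ℝ → ℝ := fun x => (x + γ) * (2⁻¹ * pcF (N x + 2) x + x * pcF (N x + 1) x) +
    N x * pcF (N x + 1) x with hK
  have hNc : Continuous N := by fun_prop
  have hN0 : ∀ x ∈ Icc (-r) 0, 0 ≤ N x := by
    intro x hx
    have : x ^ 2 ≤ r ^ 2 := sq_le_sq' hx.1 (hx.2.trans hr0.le)
    simp only [hN]
    linarith
  have hcF (c : ℝ) (hc : 0 < c) : ContinuousOn (fun x => pcF (N x + c) x) (Icc (-r) 0) := by
    intro x hx
    have hp : 0 < N x + c := by linarith [hN0 x hx]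
    have h1 := (contDiffAt_pcF (p := (N x + c, x)) hp).continuousAt
    exact (ContinuousAt.comp (f := fun x => (N x + c, x)) h1
      (by fun_prop : Continuous fun x => (N x + c, x)).continuousAt).continuousWithinAt
  have hKc : ContinuousOn K (Icc (-r) 0) := by
    have h2 := hcF 2 two_pos
    have h1 := hcF 1 one_pos
    simp only [hK]
    fun_prop
  have hKl : K (-r) < 0 := by
    have hNr : N (-r) = 0 := by
      simp only [hN]
      linarith
    have hrec := pcF_recursion le_rfl (-r)
    rw [Real.rpow_zero] at hrec
    simp only [hK, hNr]
    have : 2⁻¹ * pcF (0 + 2) (-r) + -r * pcF (0 + 1) (-r) = 1 := by linarith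
    rw [this]
    nlinarith [abs_le_of_sq_le_sq (show γ ^ 2 ≤ r ^ 2 by linarith) hr0.le]
  have hKr : 0 < K 0 := by
    have hNp : 0 < N 0 := by
      simp only [hN]
      positivity
    have hF := pcF_pos hNp 0
    have hF1 := pcF_pos (show 0 < N 0 + 1 by linarith) 0
    have hW := pcW_neg hNp le_rfl
    have hNv : 1 - 2 * N 0 = -γ ^ 2 := by
      simp only [hN]
      ring
    simp only [pcW, pcU, pcV, hNv] at hW
    norm_num at hW
    have habs := abs_lt_of_sq_lt_sq (show (γ * pcF (N 0) 0) ^ 2 < pcF (N 0 + 1) 0 ^ 2 by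
      nlinarith) hF1.le
    have hval : K 0 = N 0 * (γ * pcF (N 0) 0 + pcF (N 0 + 1) 0) := by
      simp only [hK]
      linear_combination -γ * mul_pcF hNp 0
    rw [hval]
    exact mul_pos hNp (by linarith [(abs_lt.1 habs).1])
  obtain ⟨x, hx, hKx⟩ := intermediate_value_Ioo (by linarith : -r ≤ 0) hKc ⟨hKl, hKr⟩
  have hlt : x ^ 2 < r ^ 2 := sq_lt_sq' hx.1 (hx.2.trans hr0)
  have hNp : 0 < N x := by
    simp only [hN]
    linarith
  refine ⟨x, hx.2, by linarith, ?_⟩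
  have hval : K x = N x * pcPsi (γ, x) := by
    simp only [hK, pcPsi]
    linear_combination (-(x + γ)) * mul_pcF hNp x
  exact (mul_eq_zero.1 (hval.symm.trans hKx)).resolve_left hNp.ne'

lemma contDiffAt_pcPsi {p : ℝ × ℝ} (hp : 0 < 1 - p.2 ^ 2 + p.1 ^ 2) :
    ContDiffAt ℝ (⊤ : ℕ∞) pcPsi p := by
  have h0 : 0 < (1 - p.2 ^ 2 + p.1 ^ 2) / 2 := by linarith
  have hF (c : ℝ) (hc : 0 ≤ c) : ContDiffAt ℝ (⊤ : ℕ∞)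
      (fun p : ℝ × ℝ => pcF ((1 - p.2 ^ 2 + p.1 ^ 2) / 2 + c) p.2) p :=
    ContDiffAt.comp (f := fun p : ℝ × ℝ => ((1 - p.2 ^ 2 + p.1 ^ 2) / 2 + c, p.2)) p
      (contDiffAt_pcF (p := ((1 - p.2 ^ 2 + p.1 ^ 2) / 2 + c, p.2)) (by simpa using by linarith))
      (by fun_prop)
  have h1 := hF 0 le_rfl
  simp only [add_zero] at h1
  exact ((contDiffAt_snd.add contDiffAt_fst).mul h1).add (hF 1 zero_le_one)

lemma hasDerivAt_pcF_comp {γ x c : ℝ} (hν : 0 < (1 - x ^ 2 + γ ^ 2) / 2 + c) :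
    HasDerivAt (fun x => pcF ((1 - x ^ 2 + γ ^ 2) / 2 + c) x)
      (-x * pcFLog ((1 - x ^ 2 + γ ^ 2) / 2 + c) x - pcF ((1 - x ^ 2 + γ ^ 2) / 2 + c + 1) x)
      x := by
  have h1 : HasDerivAt (fun x : ℝ => (1 - x ^ 2 + γ ^ 2) / 2 + c) (-x) x := by
    refine (((((hasDerivAt_pow 2 x).const_sub 1).add_const (γ ^ 2)).div_const 2).add_const
      c).congr_deriv ?_
    push_cast
    ring
  have h2 := HasFDerivAt.comp_hasDerivAt (f := fun x => ((1 - x ^ 2 + γ ^ 2) / 2 + c, x)) x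
    (hasFDerivAt_pcF (p := ((1 - x ^ 2 + γ ^ 2) / 2 + c, x)) hν) (h1.prodMk (hasDerivAt_id x))
  refine h2.congr_deriv ?_
  simp
  ring

lemma exists_hasDerivAt_pcPsi_ne_zero {γ x : ℝ} (hν : 0 < 1 - x ^ 2 + γ ^ 2) (hx : x < 0)
    (h : pcPsi (γ, x) = 0) : ∃ d ≠ 0, HasDerivAt (fun x => pcPsi (γ, x)) d x := by
  have hν' : 0 < (1 - x ^ 2 + γ ^ 2) / 2 := by linarith
  have h0 := hasDerivAt_pcF_comp (γ := γ) (x := x) (c := 0) (by linarith)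
  have h1 := hasDerivAt_pcF_comp (γ := γ) (x := x) (c := 1) (by linarith)
  simp only [add_zero] at h0
  have hd := (((hasDerivAt_id x).add_const γ).mul h0).add h1
  refine ⟨_, ?_, hd⟩
  simp only [id, one_mul]
  have hcov := pcFLog_covariance_pos hν' x
  have hrec := mul_pcF hν' x
  have hF := pcF_pos hν' x
  simp only [pcPsi] at h
  set ν := (1 - x ^ 2 + γ ^ 2) / 2 with hνdef
  rw [show ν + 1 + 1 = ν + 2 by ring]
  have hF1 : pcF (ν + 1) x = -(x + γ) * pcF ν x := by linarith
  have hF2 : pcF (ν + 2) x = (1 + (x + γ) ^ 2) * pcF ν x := by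
    rw [hF1] at hrec
    linear_combination -2 * hrec + 2 * pcF ν x * hνdef
  refine fun hzero => (mul_pos (neg_pos.2 hx) hcov).ne' ?_
  rw [hF2] at hzero
  rw [hF1] at hzero ⊢
  linear_combination pcF ν x * hzero

/-- The function `γ ↦ Θ(γ)` is of class `C^∞` on `ℝ`. -/
theorem Theta_smooth : ContDiff ℝ (⊤ : ℕ∞) Theta := by
  rw [contDiff_iff_contDiffAt]
  intro γ
  obtain ⟨x, hx, hν, hzero⟩ := exists_pcPsi_eq_zero γ
  have hcd : ContDiffAt ℝ (⊤ : ℕ∞) pcPsi (γ, x) := contDiffAt_pcPsi hν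
  have hn : ((⊤ : ℕ∞) : WithTop ℕ∞) ≠ 0 := by simp
  have hinv : (fderiv ℝ pcPsi (γ, x) ∘L .inr ℝ ℝ ℝ).IsInvertible := by
    obtain ⟨d, hd, hder⟩ := exists_hasDerivAt_pcPsi_ne_zero hν hx hzero
    have hchain := (hcd.differentiableAt hn).hasFDerivAt.comp_hasDerivAt x
      ((hasDerivAt_const x γ).prodMk (hasDerivAt_id x))
    have hval : fderiv ℝ pcPsi (γ, x) (0, 1) = d := hchain.unique hder
    refine ⟨ContinuousLinearEquiv.unitsEquivAut ℝ (Units.mk0 d hd), ?_⟩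
    ext
    simp [hval]
  have hψ := hcd.contDiffAt_implicitFunction hn hinv
  have hself : hcd.implicitFunction hn hinv γ = x := hcd.implicitFunction_apply_self hn hinv
  have hev := hcd.eventually_apply_implicitFunction hn hinv
  set ψ := hcd.implicitFunction hn hinv
  have hψc : ContinuousAt ψ γ := hψ.continuousAt
  have hneg : ∀ᶠ y in nhds γ, ψ y < 0 :=
    hψc.eventually_lt continuousAt_const (by rwa [hself])
  have hpos : ∀ᶠ y in nhds γ, 0 < 1 - ψ y ^ 2 + y ^ 2 :=
    continuousAt_const.eventually_lt (by fun_prop : ContinuousAt (fun y => 1 - ψ y ^ 2 + y ^ 2) γ)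
      (by rwa [hself])
  refine ((hψ.pow 2).sub (contDiffAt_id.pow 2)).congr_of_eventuallyEq ?_
  filter_upwards [hneg, hpos, hev] with y h1 h2 h3
  exact Theta_eq_of_pcPsi_eq_zero h2 h1 (h3.trans hzero)
end
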